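/- A posteriori error estimate for filtered quantities: there exists a constant C > 0, independent of N, h, ν, δ, T and the data, such that the following holds. Let u be a smooth periodic solution of the viscous Burgers equation with viscosity ν ≥ 0 and smooth 1-periodic initial data u₀; let u_h solve the mass-lumped Galerkin scheme with linear artificial viscosity on [0,T] with initial nodal values u_h(·,0) = π_h u₀; set D₀ := (1/2)·( sup_x u₀'(x) + max_i d_i(0) ) and assume D₀ ≥ 0; let δ > 0, let ũ and ũ_h be the differential filters (width δ) of u(·,T) and u_h(·,T), and set ẽ := ũ − ũ_h. Assume the linearized dual adjoint problem with coefficient a := (u + u_h)/2, viscosity ν and terminal data ẽ admits a smooth solution. Then ⟦ẽ⟧_δ ≤ C·exp(D₀·T)·(h/δ²)^{1/2}·[ h^{1/2}·‖u₀ − π_h u₀‖_{L²(0,1)} + h^{1/2}·∫₀^T inf_{v ∈ V_h} ‖v + u_h·∂_x u_h‖_{L²(0,1)} dt + U₀^{1/2}·∫₀^T ( h·∑_i max(0, ν̂ − ν)·d_i(t)² )^{1/2} dt + h^{3/2}·∫₀^T ( h·∑_i d_i'(t)² )^{1/2} dt + h·( ν·∫₀^T ∑_i (d_i(t) − d_{i−1}(t))²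 dt )^{1/2} ], where U₀ := max_j |u_j(0)| and ν̂ := max(U₀·h/2, ν). -/

import Mathlib

open Set

/-- The continuous, 1-periodic, piecewise linear function on the uniform mesh
`xᵢ = i/N`, `i ∈ ZMod N`, with nodal values `v`: on the element
`[xᵢ, xᵢ₊₁]` it equals `vᵢ + (x − xᵢ)·(vᵢ₊₁ − vᵢ)/h`, `h = 1/N`. -/
noncomputable def plin (N : ℕ) (v : ZMod N → ℝ) (x : ℝ) : ℝ :=
  v ((⌊x * (N : ℝ)⌋ : ℤ) : ZMod N)
    + (x * (N : ℝ) - (⌊x * (N : ℝ)⌋ : ℤ)) *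
        (v (((⌊x * (N : ℝ)⌋ : ℤ) : ZMod N) + 1) - v ((⌊x * (N : ℝ)⌋ : ℤ) : ZMod N))

/-- The piecewise constant space derivative of `plin N v`: on the element
`[xᵢ, xᵢ₊₁]` it equals `(vᵢ₊₁ − vᵢ)/h = N (vᵢ₊₁ − vᵢ)`. -/
noncomputable def pconst (N : ℕ) (v : ZMod N → ℝ) (x : ℝ) : ℝ :=
  (N : ℝ) * (v (((⌊x * (N : ℝ)⌋ : ℤ) : ZMod N) + 1) - v ((⌊x * (N : ℝ)⌋ : ℤ) : ZMod N))

open MeasureTheory intervalIntegral Filter Topology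

/-! ### Piecewise linear functions -/

lemma plin_eq_sum (N : ℕ) [NeZero N] (v : ZMod N → ℝ) (x : ℝ) :
    plin N v x = ∑ i : ZMod N, v i * plin N (Pi.single i 1) x := by
  have key : ∀ j : ZMod N, v j = ∑ i : ZMod N, v i * (Pi.single i 1 : ZMod N → ℝ) j := by
    intro j
    simp [Pi.single_apply]
  unfold plin
  conv_lhs => rw [key (⌊x * (N : ℝ)⌋ : ℤ), key (((⌊x * (N : ℝ)⌋ : ℤ) : ZMod N) + 1)]
  rw [← Finset.sum_sub_distrib, Finset.mul_sum, ← Finset.sum_add_distrib]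
  refine Finset.sum_congr rfl fun i _ => ?_
  ring

lemma plin_on_elt (N : ℕ) (v : ZMod N → ℝ) (k : ℤ) (x : ℝ) (h1 : (k : ℝ) ≤ x * N)
    (h2 : x * N ≤ k + 1) :
    plin N v x = v (k : ZMod N) + (x * N - k) * (v ((k : ZMod N) + 1) - v (k : ZMod N)) := by
  rcases h2.lt_or_eq with h | h
  · have : ⌊x * (N : ℝ)⌋ = k := Int.floor_eq_iff.2 ⟨h1, h⟩
    simp [plin, this]
  · have h' : x * (N : ℝ) = ((k + 1 : ℤ) : ℝ) := by push_cast; exact h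
    have : ⌊x * (N : ℝ)⌋ = k + 1 := by rw [h']; exact Int.floor_intCast _
    simp only [plin, this]
    rw [h']
    push_cast
    ring

lemma pconst_on_elt (N : ℕ) (v : ZMod N → ℝ) (k : ℤ) (x : ℝ) (h1 : (k : ℝ) ≤ x * N)
    (h2 : x * N < k + 1) :
    pconst N v x = N * (v ((k : ZMod N) + 1) - v (k : ZMod N)) := by
  have : ⌊x * (N : ℝ)⌋ = k := Int.floor_eq_iff.2 ⟨h1, h2⟩
  simp [pconst, this]

lemma plin_hasDeriv_right (N : ℕ) (v : ZMod N → ℝ) (x : ℝ) :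
    HasDerivWithinAt (plin N v) (pconst N v x) (Ici x) x := by
  set k : ℤ := ⌊x * (N : ℝ)⌋ with hk
  have hc : Continuous fun y : ℝ => y * (N : ℝ) := by fun_prop
  have hev : ∀ᶠ y in 𝓝 x, y * (N : ℝ) < k + 1 :=
    hc.continuousAt.eventually_lt_const (Int.lt_floor_add_one _)
  have heq : plin N v =ᶠ[𝓝[Ici x] x]
      fun y => v (k : ZMod N) + (y * N - k) * (v ((k : ZMod N) + 1) - v (k : ZMod N)) := by
    filter_upwards [nhdsWithin_le_nhds hev, self_mem_nhdsWithin] with y hy hxy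
    have hxy' : x ≤ y := hxy
    have : (k : ℝ) ≤ x * N := Int.floor_le _
    have h3 : x * (N : ℝ) ≤ y * N := by gcongr
    exact plin_on_elt N v k y (this.trans h3) hy.le
  have hd : HasDerivWithinAt
      (fun y : ℝ => v (k : ZMod N) + (y * N - k) * (v ((k : ZMod N) + 1) - v (k : ZMod N)))
      (pconst N v x) (Ici x) x := by
    have : HasDerivAt
      (fun y : ℝ => v (k : ZMod N) + (y * N - k) * (v ((k : ZMod N) + 1) - v (k : ZMod N)))
      ((1 * (N : ℝ)) * (v ((k : ZMod N) + 1) - v (k : ZMod N))) x :=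
      ((((hasDerivAt_id x).mul_const (N : ℝ)).sub_const (k : ℝ)).mul_const _).const_add _
    rw [one_mul] at this
    exact this.hasDerivWithinAt
  exact hd.congr_of_eventuallyEq heq (heq.self_of_nhdsWithin self_mem_Ici)

lemma plin_continuous (N : ℕ) (v : ZMod N → ℝ) : Continuous (plin N v) := by
  rw [continuous_iff_continuousAt]
  intro x
  rw [continuousAt_iff_continuous_left_right]
  refine ⟨?_, (plin_hasDeriv_right N v x).continuousWithinAt⟩
  set k : ℤ := ⌈x * (N : ℝ)⌉ - 1 with hk
  have hc : Continuous fun y : ℝ => y * (N : ℝ) := by fun_prop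
  have hkx : (k : ℝ) < x * N := by
    have := Int.ceil_lt_add_one (x * (N : ℝ))
    rw [hk]; push_cast; linarith
  have hkx2 : x * (N : ℝ) ≤ k + 1 := by
    have := Int.le_ceil (x * (N : ℝ))
    rw [hk]; push_cast; linarith
  have hev : ∀ᶠ y in 𝓝 x, (k : ℝ) < y * (N : ℝ) :=
    hc.continuousAt.eventually_const_lt hkx
  have heq : plin N v =ᶠ[𝓝[Iic x] x]
      fun y => v (k : ZMod N) + (y * N - k) * (v ((k : ZMod N) + 1) - v (k : ZMod N)) := by
    filter_upwards [nhdsWithin_le_nhds hev, self_mem_nhdsWithin] with y hy hxy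
    have hxy' : y ≤ x := hxy
    have h3 : y * (N : ℝ) ≤ x * N := by gcongr
    exact plin_on_elt N v k y hy.le (h3.trans hkx2)
  have hcc : ContinuousWithinAt
      (fun y : ℝ => v (k : ZMod N) + (y * N - k) * (v ((k : ZMod N) + 1) - v (k : ZMod N)))
      (Iic x) x := by
    apply Continuous.continuousWithinAt
    fun_prop
  exact hcc.congr_of_eventuallyEq heq (heq.self_of_nhdsWithin self_mem_Iic)

lemma floor_add_one_mul (N : ℕ) (x : ℝ) :
    (((⌊(x + 1) * (N : ℝ)⌋ : ℤ)) : ZMod N) = ((⌊x * (N : ℝ)⌋ : ℤ) : ZMod N) := by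
  have : (x + 1) * (N : ℝ) = x * N + (N : ℤ) := by push_cast; ring
  rw [this, Int.floor_add_intCast]
  push_cast
  simp

lemma plin_periodic (N : ℕ) (v : ZMod N → ℝ) (x : ℝ) : plin N v (x + 1) = plin N v x := by
  unfold plin
  rw [floor_add_one_mul]
  have : (x + 1) * (N : ℝ) = x * N + (N : ℤ) := by push_cast; ring
  rw [this, Int.floor_add_intCast]
  push_cast
  ring

lemma pconst_measurable (N : ℕ) (v : ZMod N → ℝ) : Measurable (pconst N v) := by
  have h1 : Measurable fun x : ℝ => ⌊x * (N : ℝ)⌋ :=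
    Int.measurable_floor.comp (measurable_id.mul_const _)
  exact (measurable_from_top (f := fun k : ℤ =>
    (N : ℝ) * (v ((k : ZMod N) + 1) - v (k : ZMod N)))).comp h1

lemma pconst_intervalIntegrable (N : ℕ) [NeZero N] (v : ZMod N → ℝ) (a b : ℝ) :
    IntervalIntegrable (pconst N v) volume a b := by
  have hb : ∀ x, ‖pconst N v x‖ ≤ ∑ i : ZMod N, |(N : ℝ) * (v (i + 1) - v i)| := by
    intro x
    unfold pconst
    rw [Real.norm_eq_abs]
    exact Finset.single_le_sum (f := fun i : ZMod N => |(N : ℝ) * (v (i + 1) - v i)|)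
      (fun i _ => abs_nonneg _) (Finset.mem_univ _)
  refine (intervalIntegrable_const (c := ∑ i : ZMod N, |(N : ℝ) * (v (i + 1) - v i)|)).mono_fun
    (pconst_measurable N v).aestronglyMeasurable ?_
  refine Filter.Eventually.of_forall fun x => ?_
  exact (hb x).trans (le_abs_self _)

lemma pconst_le (N : ℕ) (v : ZMod N → ℝ) (M : ℝ) (hM : ∀ i, (N : ℝ) * (v (i + 1) - v i) ≤ M)
    (x : ℝ) : pconst N v x ≤ M := hM _

/-! ### Sums and integrals over elements -/

lemma sum_zmod_eq_range (N : ℕ) [NeZero N] (f : ZMod N → ℝ) :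
    ∑ i : ZMod N, f i = ∑ k ∈ Finset.range N, f (k : ZMod N) := by
  refine Finset.sum_nbij' (fun i => i.val) (fun k => (k : ZMod N)) ?_ ?_ ?_ ?_ ?_
  · intro i _; exact Finset.mem_range.2 (ZMod.val_lt i)
  · intro k _; exact Finset.mem_univ _
  · intro i _; simp
  · intro k hk; exact ZMod.val_cast_of_lt (Finset.mem_range.1 hk)
  · intro i _; simp

lemma sum_shift (N : ℕ) [NeZero N] (f : ZMod N → ℝ) :
    ∑ i : ZMod N, f (i + 1) = ∑ i : ZMod N, f i :=
  Equiv.sum_comp (Equiv.addRight (1 : ZMod N)) f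

lemma integral_eq_sum_elt (N : ℕ) [NeZero N] (f : ℝ → ℝ)
    (hf : ∀ k < N, IntervalIntegrable f volume ((k : ℝ) / N) (((k : ℝ) + 1) / N)) :
    ∫ x in (0 : ℝ)..1, f x
      = ∑ k ∈ Finset.range N, ∫ x in ((k : ℝ) / N)..(((k : ℝ) + 1) / N), f x := by
  have hN : (N : ℝ) ≠ 0 := Nat.cast_ne_zero.2 (NeZero.ne N)
  have := sum_integral_adjacent_intervals (f := f) (μ := volume) (a := fun k : ℕ => (k : ℝ) / N)
    (n := N) (by intro k hk; simpa using hf k hk)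
  simp only [Nat.cast_zero, zero_div, div_self hN] at this
  rw [← this]
  simp

lemma elt_integral (N : ℕ) [NeZero N] (f : ℝ → ℝ) (k c0 c1 c2 : ℝ)
    (hf : ∀ x ∈ Ioo (k / N) ((k + 1) / N),
      f x = c0 + c1 * (x * N - k) + c2 * (x * N - k) ^ 2) :
    IntervalIntegrable f volume (k / N) ((k + 1) / N) ∧
    ∫ x in (k / N)..((k + 1) / N), f x = 1 / N * (c0 + c1 / 2 + c2 / 3) := by
  have hN : (0 : ℝ) < N := Nat.cast_pos.2 (NeZero.pos N)
  have hle : k / N ≤ (k + 1) / (N : ℝ) := by gcongr; linarith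
  set P : ℝ → ℝ := fun x => c0 + c1 * (x * N - k) + c2 * (x * N - k) ^ 2 with hP
  have hPc : Continuous P := by rw [hP]; fun_prop
  have hcongr : EqOn f P (Ioo (k / N) ((k + 1) / N)) := fun x hx => hf x hx
  refine ⟨?_, ?_⟩
  · rw [intervalIntegrable_iff_integrableOn_Ioo_of_le hle]
    have := (hPc.intervalIntegrable (μ := volume) (k / N) ((k + 1) / N))
    rw [intervalIntegrable_iff_integrableOn_Ioo_of_le hle] at this
    exact this.congr_fun hcongr.symm measurableSet_Ioo
  · rw [integral_congr_Ioo_of_le hle hcongr]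
    have hd : ∀ x ∈ uIcc (k / N) ((k + 1) / (N : ℝ)), HasDerivAt
        (fun x => 1 / N * (c0 * (x * N - k) + c1 * ((x * N - k) ^ 2 / 2)
          + c2 * ((x * N - k) ^ 3 / 3))) (P x) x := by
      intro x _
      have h0 : HasDerivAt (fun x : ℝ => x * N - k) (1 * (N : ℝ)) x :=
        ((hasDerivAt_id x).mul_const (N : ℝ)).sub_const k
      have := ((((h0.const_mul c0).add (((h0.pow 2).div_const 2).const_mul c1)).add
        (((h0.pow 3).div_const 3).const_mul c2))).const_mul (1 / (N : ℝ))
      refine this.congr_deriv ?_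
      simp only [hP]
      field_simp
      push_cast
      ring
    rw [integral_eq_sub_of_hasDerivAt hd (hPc.intervalIntegrable _ _)]
    field_simp
    ring

lemma full_integral (N : ℕ) [NeZero N] (f : ℝ → ℝ) (c0 c1 c2 : ZMod N → ℝ)
    (hf : ∀ (k : ℤ) (x : ℝ), (k : ℝ) ≤ x * N → x * N < k + 1 →
      f x = c0 k + c1 k * (x * N - k) + c2 k * (x * N - k) ^ 2) :
    ∫ x in (0 : ℝ)..1, f x = 1 / N * ∑ i : ZMod N, (c0 i + c1 i / 2 + c2 i / 3) := by
  have hN : (0 : ℝ) < N := Nat.cast_pos.2 (NeZero.pos N)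
  have key : ∀ k : ℕ, IntervalIntegrable f volume ((k : ℝ) / N) (((k : ℝ) + 1) / N) ∧
      ∫ x in ((k : ℝ) / N)..(((k : ℝ) + 1) / N), f x
        = 1 / N * (c0 (k : ZMod N) + c1 (k : ZMod N) / 2 + c2 (k : ZMod N) / 3) := by
    intro k
    refine elt_integral N f k _ _ _ fun x hx => ?_
    have h1 := hx.1
    have h2 := hx.2
    rw [div_lt_iff₀ hN] at h1
    rw [lt_div_iff₀ hN] at h2
    have := hf (k : ℤ) x (by push_cast; exact h1.le) (by push_cast; exact h2)
    push_cast at this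
    exact this
  rw [integral_eq_sum_elt N f (fun k _ => (key k).1), sum_zmod_eq_range, Finset.mul_sum]
  exact Finset.sum_congr rfl fun k _ => (key k).2

/-- Mass matrix. -/
lemma integral_plin_mul (N : ℕ) [NeZero N] (v z : ZMod N → ℝ) :
    ∫ x in (0 : ℝ)..1, plin N v x * plin N z x
      = 1 / N * ∑ i : ZMod N, (v i * z i / 3 + v (i + 1) * z (i + 1) / 3
          + v i * z (i + 1) / 6 + v (i + 1) * z i / 6) := by
  rw [full_integral N _ (fun i => v i * z i)
    (fun i => v i * (z (i + 1) - z i) + z i * (v (i + 1) - v i))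
    (fun i => (v (i + 1) - v i) * (z (i + 1) - z i))]
  · congr 1
    refine Finset.sum_congr rfl fun i _ => ?_
    ring
  · intro k x h1 h2
    rw [plin_on_elt N v k x h1 h2.le, plin_on_elt N z k x h1 h2.le]
    ring

lemma integral_plin (N : ℕ) [NeZero N] (v : ZMod N → ℝ) :
    ∫ x in (0 : ℝ)..1, plin N v x = 1 / N * ∑ i : ZMod N, v i := by
  rw [full_integral N _ (fun i => v i) (fun i => v (i + 1) - v i) (fun _ => 0)]
  · congr 1
    have : ∀ i : ZMod N, v i + (v (i + 1) - v i) / 2 + 0 / 3 = v i / 2 + v (i + 1) / 2 := by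
      intro i; ring
    simp_rw [this]
    rw [Finset.sum_add_distrib, sum_shift N (fun i => v i / 2), ← Finset.sum_add_distrib]
    exact Finset.sum_congr rfl fun i _ => by ring
  · intro k x h1 h2
    rw [plin_on_elt N v k x h1 h2.le]
    ring

/-- Convection term. -/
lemma integral_conv (N : ℕ) [NeZero N] (w z : ZMod N → ℝ) :
    ∫ x in (0 : ℝ)..1, plin N w x * pconst N w x * plin N z x
      = ∑ i : ZMod N, 1 / 6 * (w (i + 1) ^ 2 + w i * w (i + 1) - w i * w (i - 1)
          - w (i - 1) ^ 2) * z i := by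
  have hN : (N : ℝ) ≠ 0 := Nat.cast_ne_zero.2 (NeZero.ne N)
  rw [full_integral N _ (fun i => w i * (N * (w (i + 1) - w i)) * z i)
    (fun i => (w i * (z (i + 1) - z i) + z i * (w (i + 1) - w i)) * (N * (w (i + 1) - w i)))
    (fun i => (w (i + 1) - w i) * (z (i + 1) - z i) * (N * (w (i + 1) - w i)))]
  · have h1 : ∑ i : ZMod N, 1 / 6 * (w (i + 1) ^ 2 + w i * w (i + 1) - w i * w (i - 1)
          - w (i - 1) ^ 2) * z i
        = ∑ i : ZMod N, 1 / 6 * (w (i + 1) ^ 2 + w i * w (i + 1) - 2 * w i ^ 2) * z i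
          - ∑ i : ZMod N, 1 / 6 * (w i * w (i - 1) + w (i - 1) ^ 2 - 2 * w i ^ 2) * z i := by
      rw [← Finset.sum_sub_distrib]
      exact Finset.sum_congr rfl fun i _ => by ring
    rw [h1, ← sum_shift N (fun i => 1 / 6 * (w i * w (i - 1) + w (i - 1) ^ 2 - 2 * w i ^ 2) * z i),
      ← Finset.sum_sub_distrib, Finset.mul_sum]
    refine Finset.sum_congr rfl fun i _ => ?_
    simp only [add_sub_cancel_right]
    field_simp
    ring
  · intro k x h1 h2
    rw [plin_on_elt N w k x h1 h2.le, plin_on_elt N z k x h1 h2.le, pconst_on_elt N w k x h1 h2]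
    ring

/-- The squared best-approximation functional is a polynomial in the nodal values. -/
lemma integral_res_sq (N : ℕ) [NeZero N] (v w : ZMod N → ℝ) :
    ∫ x in (0 : ℝ)..1, (plin N v x + plin N w x * pconst N w x) ^ 2
      = 1 / N * ∑ i : ZMod N,
        ((v i + w i * (N * (w (i + 1) - w i))) ^ 2
          + 2 * (v i + w i * (N * (w (i + 1) - w i)))
              * (v (i + 1) - v i + (w (i + 1) - w i) * (N * (w (i + 1) - w i))) / 2
          + (v (i + 1) - v i + (w (i + 1) - w i) * (N * (w (i + 1) - w i))) ^ 2 / 3) := by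
  rw [full_integral N _ (fun i => (v i + w i * (N * (w (i + 1) - w i))) ^ 2)
    (fun i => 2 * (v i + w i * (N * (w (i + 1) - w i)))
              * (v (i + 1) - v i + (w (i + 1) - w i) * (N * (w (i + 1) - w i))))
    (fun i => (v (i + 1) - v i + (w (i + 1) - w i) * (N * (w (i + 1) - w i))) ^ 2)]
  intro k x h1 h2
  rw [plin_on_elt N w k x h1 h2.le, plin_on_elt N v k x h1 h2.le, pconst_on_elt N w k x h1 h2]
  ring

lemma plin_norm_lower (N : ℕ) [NeZero N] (v : ZMod N → ℝ) :
    1 / N * ∑ i : ZMod N, v i ^ 2 ≤ 3 * ∫ x in (0 : ℝ)..1, plin N v x ^ 2 := by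
  have hN : (0 : ℝ) < N := Nat.cast_pos.2 (NeZero.pos N)
  have h1 : ∫ x in (0 : ℝ)..1, plin N v x ^ 2 = ∫ x in (0 : ℝ)..1, plin N v x * plin N v x := by
    simp_rw [sq]
  rw [h1, integral_plin_mul]
  have h2 : ∑ i : ZMod N, v i ^ 2 = ∑ i : ZMod N, (v i ^ 2 / 2 + v (i + 1) ^ 2 / 2) := by
    rw [Finset.sum_add_distrib, sum_shift N (fun i => v i ^ 2 / 2), ← Finset.sum_add_distrib]
    exact Finset.sum_congr rfl fun i _ => by ring
  rw [h2]
  have h3 : ∑ i : ZMod N, (v i ^ 2 / 2 + v (i + 1) ^ 2 / 2) ≤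
      3 * ∑ i : ZMod N, (v i * v i / 3 + v (i + 1) * v (i + 1) / 3
          + v i * v (i + 1) / 6 + v (i + 1) * v i / 6) := by
    rw [Finset.mul_sum]
    refine Finset.sum_le_sum fun i _ => ?_
    nlinarith [sq_nonneg (v i + v (i + 1))]
  calc _ ≤ 1 / (N : ℝ) * (3 * ∑ i : ZMod N, (v i * v i / 3 + v (i + 1) * v (i + 1) / 3
          + v i * v (i + 1) / 6 + v (i + 1) * v i / 6)) := by gcongr
    _ = _ := by ring

open Set
open MeasureTheory intervalIntegral Filter Topology

/-! ### Inequalities for interval integrals -/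

lemma cs_integral (f g : ℝ → ℝ) (a b : ℝ) (hab : a ≤ b)
    (hf : IntervalIntegrable (fun x => f x ^ 2) volume a b)
    (hg : IntervalIntegrable (fun x => g x ^ 2) volume a b)
    (hfg : IntervalIntegrable (fun x => f x * g x) volume a b) :
    (∫ x in a..b, f x * g x) ^ 2 ≤ (∫ x in a..b, f x ^ 2) * ∫ x in a..b, g x ^ 2 := by
  have key : ∀ s : ℝ, 0 ≤ (∫ x in a..b, g x ^ 2) * (s * s)
      + (2 * ∫ x in a..b, f x * g x) * s + ∫ x in a..b, f x ^ 2 := by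
    intro s
    have h1 : ∫ x in a..b, (f x + s * g x) ^ 2 = (∫ x in a..b, g x ^ 2) * (s * s)
      + (2 * ∫ x in a..b, f x * g x) * s + ∫ x in a..b, f x ^ 2 := by
      have : ∀ x, (f x + s * g x) ^ 2 = f x ^ 2 + ((2 * s) * (f x * g x) + (s * s) * g x ^ 2) := by
        intro x; ring
      simp_rw [this]
      rw [integral_add hf ((hfg.const_mul _).add (hg.const_mul _)),
        integral_add (hfg.const_mul _) (hg.const_mul _), intervalIntegral.integral_const_mul,
        intervalIntegral.integral_const_mul]
      ring
    rw [← h1]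
    exact integral_nonneg hab fun x _ => sq_nonneg _
  have := discrim_le_zero key
  unfold discrim at this
  nlinarith

lemma cs_integral_sqrt (f g : ℝ → ℝ) (a b : ℝ) (hab : a ≤ b)
    (hf : IntervalIntegrable (fun x => f x ^ 2) volume a b)
    (hg : IntervalIntegrable (fun x => g x ^ 2) volume a b)
    (hfg : IntervalIntegrable (fun x => f x * g x) volume a b) :
    |∫ x in a..b, f x * g x| ≤ √(∫ x in a..b, f x ^ 2) * √(∫ x in a..b, g x ^ 2) := by
  rw [← Real.sqrt_mul (integral_nonneg hab fun x _ => sq_nonneg _)]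
  exact Real.abs_le_sqrt (cs_integral f g a b hab hf hg hfg)

lemma sq_integral_abs_le (f : ℝ → ℝ) (hf : Continuous f) (a b : ℝ) (hab : a ≤ b) :
    (∫ x in a..b, |f x|) ^ 2 ≤ (b - a) * ∫ x in a..b, f x ^ 2 := by
  have := cs_integral (fun x => |f x|) (fun _ => 1) a b hab
    ((hf.abs.pow 2).intervalIntegrable _ _) (by simp) (by simpa using hf.abs.intervalIntegrable a b)
  simp only [sq_abs, mul_one, one_pow, intervalIntegral.integral_const, smul_eq_mul] at this
  linarith

/-- Integration by parts for periodic functions with right derivatives. -/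
lemma ibp_periodic (f g f' g' : ℝ → ℝ) (hf : Continuous f) (hg : Continuous g)
    (hfd : ∀ x, HasDerivWithinAt f (f' x) (Ici x) x)
    (hgd : ∀ x, HasDerivWithinAt g (g' x) (Ici x) x)
    (hf' : IntervalIntegrable f' volume 0 1) (hg' : IntervalIntegrable g' volume 0 1)
    (hfp : f 1 = f 0) (hgp : g 1 = g 0) :
    ∫ x in (0 : ℝ)..1, f' x * g x = - ∫ x in (0 : ℝ)..1, f x * g' x := by
  have := integral_deriv_mul_eq_sub_of_hasDeriv_right (a := 0) (b := 1) hf.continuousOn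
    hg.continuousOn (fun x _ => (hfd x).mono Ioi_subset_Ici_self)
    (fun x _ => (hgd x).mono Ioi_subset_Ici_self) hf' hg'
  rw [integral_add (hf'.mul_continuousOn hg.continuousOn) (hg'.continuousOn_mul hf.continuousOn),
    hfp, hgp] at this
  linarith

/-! ### Interpolation -/

lemma abs_sub_le_integral_abs (ψ E : ℝ → ℝ) (hE : Continuous E)
    (hψ : ∀ x, HasDerivAt ψ (E x) x) (a b x y : ℝ) (hax : a ≤ x) (hxy : x ≤ y) (hyb : y ≤ b) :
    |ψ y - ψ x| ≤ ∫ t in a..b, |E t| := by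
  rw [← integral_eq_sub_of_hasDerivAt (fun t _ => hψ t) (hE.intervalIntegrable x y)]
  refine (abs_integral_le_integral_abs hxy).trans ?_
  exact integral_mono_interval hax hxy hyb (Eventually.of_forall fun t => abs_nonneg _)
    (hE.abs.intervalIntegrable _ _)

lemma elt_pt (ψ E : ℝ → ℝ) (hE : Continuous E) (hψ : ∀ x, HasDerivAt ψ (E x) x)
    (a b x s : ℝ) (hax : a ≤ x) (hxb : x ≤ b) (hs0 : 0 ≤ s) (hs1 : s ≤ 1) :
    |ψ x - (ψ a + s * (ψ b - ψ a))| ≤ ∫ t in a..b, |E t| := by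
  have h1 := abs_sub_le_integral_abs ψ E hE hψ a b a x le_rfl hax hxb
  have h2 := abs_sub_le_integral_abs ψ E hE hψ a b x b hax hxb le_rfl
  rw [abs_le] at h1 h2 ⊢
  constructor <;> nlinarith

lemma elt_pt2 (ψ E e : ℝ → ℝ) (he : Continuous e) (hψ : ∀ x, HasDerivAt ψ (E x) x)
    (hEd : ∀ x, HasDerivAt E (e x) x)
    (a b x s : ℝ) (hax : a ≤ x) (hxb : x ≤ b) (hs0 : 0 ≤ s) (hs1 : s ≤ 1)
    (hxs : x = a + s * (b - a)) :
    |ψ x - (ψ a + s * (ψ b - ψ a))| ≤ (b - a) * ∫ t in a..b, |e t| := by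
  have hE : Continuous E := continuous_iff_continuousAt.2 fun x => (hEd x).continuousAt
  have h1 := elt_pt (fun y => ψ y - E a * (y - a)) (fun y => E y - E a)
    (hE.sub continuous_const) (fun y => by
      have := (hψ y).sub (((hasDerivAt_id y).sub_const a).const_mul (E a))
      exact this.congr_deriv (by ring)) a b x s hax hxb hs0 hs1
  have h2 : ψ x - (ψ a + s * (ψ b - ψ a)) = ψ x - E a * (x - a) - (ψ a - E a * (a - a)
      + s * (ψ b - E a * (b - a) - (ψ a - E a * (a - a)))) := by
    rw [hxs]; ring
  rw [h2]
  refine h1.trans ?_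
  have hab := hax.trans hxb
  calc ∫ t in a..b, |E t - E a| ≤ ∫ t in a..b, (∫ r in a..b, |e r|) := by
        refine integral_mono_on hab ((hE.sub continuous_const).abs.intervalIntegrable _ _)
          (by simp) fun t ht => ?_
        exact abs_sub_le_integral_abs E e he hEd a b a t le_rfl ht.1 ht.2
    _ = _ := by simp

/-- Nodal values of a function. -/
noncomputable def nodal (N : ℕ) (ψ : ℝ → ℝ) (i : ZMod N) : ℝ := ψ ((i.val : ℝ) / N)

lemma nodal_int (N : ℕ) [NeZero N] (ψ : ℝ → ℝ) (hp : ∀ x, ψ (x + 1) = ψ x) (k : ℤ) :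
    nodal N ψ (k : ZMod N) = ψ ((k : ℝ) / N) := by
  have hN : (N : ℝ) ≠ 0 := Nat.cast_ne_zero.2 (NeZero.ne N)
  unfold nodal
  have h1 : ((((k : ZMod N)).val : ℤ)) = k % N := ZMod.val_intCast k
  have h2 : (((k : ZMod N)).val : ℝ) = ((k % N : ℤ) : ℝ) := by rw [← h1]; simp
  rw [h2]
  have h3 : (k : ℝ) / N = ((k % N : ℤ) : ℝ) / N + (k / N : ℤ) • (1 : ℝ) := by
    have : (k : ℝ) = ((k % N : ℤ) : ℝ) + (N : ℝ) * ((k / N : ℤ) : ℝ) := by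
      exact_mod_cast (Int.emod_add_mul_ediv k N).symm
    conv_lhs => rw [this]
    field_simp
    simp
  rw [h3]
  have hper : Function.Periodic ψ 1 := hp
  exact ((hper.zsmul (k / N)) _).symm

lemma nodal_nat (N : ℕ) [NeZero N] (ψ : ℝ → ℝ) (hp : ∀ x, ψ (x + 1) = ψ x) (k : ℕ) :
    nodal N ψ (k : ZMod N) = ψ ((k : ℝ) / N) := by
  simpa using nodal_int N ψ hp (k : ℤ)

lemma nodal_nat_succ (N : ℕ) [NeZero N] (ψ : ℝ → ℝ) (hp : ∀ x, ψ (x + 1) = ψ x) (k : ℕ) :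
    nodal N ψ ((k : ZMod N) + 1) = ψ (((k : ℝ) + 1) / N) := by
  simpa using nodal_nat N ψ hp (k + 1)

lemma elt_le (N : ℕ) [NeZero N] (k : ℝ) : k / N ≤ (k + 1) / (N : ℝ) := by
  have hN : (0 : ℝ) < N := Nat.cast_pos.2 (NeZero.pos N)
  gcongr; linarith

/-- Element-wise pointwise bounds sum to an integral bound. -/
lemma sum_elt_bound (N : ℕ) [NeZero N] (F G : ℝ → ℝ) (c : ℝ) (hF : Continuous F)
    (hG : Continuous G)
    (hb : ∀ k : ℕ, ∀ x ∈ Icc ((k : ℝ) / N) (((k : ℝ) + 1) / N),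
      F x ≤ c * ∫ t in ((k : ℝ) / N)..(((k : ℝ) + 1) / N), G t) :
    ∫ x in (0 : ℝ)..1, F x ≤ c * (1 / N) * ∫ x in (0 : ℝ)..1, G x := by
  rw [integral_eq_sum_elt N F (fun k _ => hF.intervalIntegrable _ _),
    integral_eq_sum_elt N G (fun k _ => hG.intervalIntegrable _ _), Finset.mul_sum]
  refine Finset.sum_le_sum fun k _ => ?_
  have h1 : ∫ x in ((k : ℝ) / N)..(((k : ℝ) + 1) / N), F x
      ≤ ∫ x in ((k : ℝ) / N)..(((k : ℝ) + 1) / N),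
        (c * ∫ t in ((k : ℝ) / N)..(((k : ℝ) + 1) / N), G t) :=
    integral_mono_on (elt_le N k) (hF.intervalIntegrable _ _) (by simp) (hb k)
  refine h1.trans (le_of_eq ?_)
  rw [intervalIntegral.integral_const, smul_eq_mul]
  ring

lemma plin_nodal_elt (N : ℕ) [NeZero N] (ψ : ℝ → ℝ) (hp : ∀ x, ψ (x + 1) = ψ x) (k : ℕ)
    (x : ℝ) (hx : x ∈ Icc ((k : ℝ) / N) (((k : ℝ) + 1) / N)) :
    plin N (nodal N ψ) x = ψ ((k : ℝ) / N)
        + (x * N - k) * (ψ (((k : ℝ) + 1) / N) - ψ ((k : ℝ) / N)) ∧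
      0 ≤ x * N - k ∧ x * N - k ≤ 1 := by
  have hN : (0 : ℝ) < N := Nat.cast_pos.2 (NeZero.pos N)
  have h1 := hx.1
  have h2 := hx.2
  rw [div_le_iff₀ hN] at h1
  rw [le_div_iff₀ hN] at h2
  refine ⟨?_, by linarith, by linarith⟩
  have := plin_on_elt N (nodal N ψ) (k : ℤ) x (by exact_mod_cast h1) (by exact_mod_cast h2)
  rw [this]
  push_cast
  rw [nodal_nat N ψ hp, nodal_nat_succ N ψ hp]

lemma interp_err1 (N : ℕ) [NeZero N] (ψ E : ℝ → ℝ) (hp : ∀ x, ψ (x + 1) = ψ x)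
    (hE : Continuous E) (hψ : ∀ x, HasDerivAt ψ (E x) x) :
    ∫ x in (0 : ℝ)..1, (ψ x - plin N (nodal N ψ) x) ^ 2
      ≤ (1 / N) ^ 2 * ∫ x in (0 : ℝ)..1, E x ^ 2 := by
  have hψc : Continuous ψ := continuous_iff_continuousAt.2 fun x => (hψ x).continuousAt
  have := sum_elt_bound N (fun x => (ψ x - plin N (nodal N ψ) x) ^ 2) (fun x => E x ^ 2) (1 / N)
    ((hψc.sub (plin_continuous N _)).pow 2) (hE.pow 2) (by
      intro k x hx
      obtain ⟨h1, h2, h3⟩ := plin_nodal_elt N ψ hp k x hx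
      rw [h1, ← sq_abs]
      have h4 := elt_pt ψ E hE hψ _ _ x _ hx.1 hx.2 h2 h3
      have h5 := sq_integral_abs_le E hE _ _ (elt_le N k)
      have h6 : ((k : ℝ) + 1) / N - k / N = 1 / N := by ring
      rw [h6] at h5
      exact (pow_le_pow_left₀ (abs_nonneg _) h4 2).trans h5)
  refine this.trans (le_of_eq ?_)
  ring

lemma interp_err2 (N : ℕ) [NeZero N] (ψ E e : ℝ → ℝ) (hp : ∀ x, ψ (x + 1) = ψ x)
    (he : Continuous e) (hψ : ∀ x, HasDerivAt ψ (E x) x) (hEd : ∀ x, HasDerivAt E (e x) x) :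
    ∫ x in (0 : ℝ)..1, (ψ x - plin N (nodal N ψ) x) ^ 2
      ≤ (1 / N) ^ 4 * ∫ x in (0 : ℝ)..1, e x ^ 2 := by
  have hN : (0 : ℝ) < N := Nat.cast_pos.2 (NeZero.pos N)
  have hψc : Continuous ψ := continuous_iff_continuousAt.2 fun x => (hψ x).continuousAt
  have := sum_elt_bound N (fun x => (ψ x - plin N (nodal N ψ) x) ^ 2) (fun x => e x ^ 2)
    ((1 / N) ^ 3)
    ((hψc.sub (plin_continuous N _)).pow 2) (he.pow 2) (by
      intro k x hx
      obtain ⟨h1, h2, h3⟩ := plin_nodal_elt N ψ hp k x hx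
      rw [h1, ← sq_abs]
      have h6 : ((k : ℝ) + 1) / N - k / N = 1 / N := by ring
      have h4 := elt_pt2 ψ E e he hψ hEd _ _ x _ hx.1 hx.2 h2 h3 (by
        rw [h6]; field_simp; ring)
      have h5 := sq_integral_abs_le e he _ _ (elt_le N k)
      rw [h6] at h5 h4
      refine (pow_le_pow_left₀ (abs_nonneg _) h4 2).trans ?_
      rw [mul_pow]
      calc (1 / (N : ℝ)) ^ 2 * (∫ t in ((k : ℝ) / N)..(((k : ℝ) + 1) / N), |e t|) ^ 2
          ≤ (1 / (N : ℝ)) ^ 2 * (1 / N * ∫ t in ((k : ℝ) / N)..(((k : ℝ) + 1) / N), e t ^ 2) := by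
            gcongr
        _ = _ := by ring)
  refine this.trans (le_of_eq ?_)
  ring

lemma nodal_diff_sq (N : ℕ) [NeZero N] (ψ E : ℝ → ℝ) (hp : ∀ x, ψ (x + 1) = ψ x)
    (hE : Continuous E) (hψ : ∀ x, HasDerivAt ψ (E x) x) :
    ∑ i : ZMod N, (nodal N ψ (i + 1) - nodal N ψ i) ^ 2 ≤ 1 / N * ∫ x in (0 : ℝ)..1, E x ^ 2 := by
  rw [sum_zmod_eq_range, integral_eq_sum_elt N (fun x => E x ^ 2)
    (fun k _ => (hE.pow 2).intervalIntegrable _ _), Finset.mul_sum]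
  refine Finset.sum_le_sum fun k _ => ?_
  rw [nodal_nat N ψ hp, nodal_nat_succ N ψ hp, ← sq_abs]
  have h4 := abs_sub_le_integral_abs ψ E hE hψ _ _ _ _ le_rfl (elt_le N k) le_rfl
  have h5 := sq_integral_abs_le E hE _ _ (elt_le N k)
  have h6 : ((k : ℝ) + 1) / N - k / N = 1 / N := by ring
  rw [h6] at h5
  exact (pow_le_pow_left₀ (abs_nonneg _) h4 2).trans h5

lemma integral_pconst_mul (N : ℕ) [NeZero N] (w : ZMod N → ℝ) (ψ E : ℝ → ℝ)
    (hp : ∀ x, ψ (x + 1) = ψ x) (hE : Continuous E) (hψ : ∀ x, HasDerivAt ψ (E x) x) :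
    ∫ x in (0 : ℝ)..1, pconst N w x * E x
      = ∑ i : ZMod N, N * (w (i + 1) - w i) * (nodal N ψ (i + 1) - nodal N ψ i) := by
  have hN : (0 : ℝ) < N := Nat.cast_pos.2 (NeZero.pos N)
  rw [sum_zmod_eq_range, integral_eq_sum_elt N (fun x => pconst N w x * E x)
    (fun k _ => (pconst_intervalIntegrable N w _ _).mul_continuousOn hE.continuousOn)]
  refine Finset.sum_congr rfl fun k _ => ?_
  rw [nodal_nat N ψ hp, nodal_nat_succ N ψ hp,
    ← integral_eq_sub_of_hasDerivAt (fun t _ => hψ t) (hE.intervalIntegrable _ _),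
    ← intervalIntegral.integral_const_mul]
  refine integral_congr_Ioo_of_le (elt_le N k) fun x hx => ?_
  have h1 := hx.1
  have h2 := hx.2
  rw [div_lt_iff₀ hN] at h1
  rw [lt_div_iff₀ hN] at h2
  have := pconst_on_elt N w (k : ℤ) x (by push_cast; exact h1.le) (by push_cast; exact h2)
  simp only [this]
  push_cast
  ring

lemma plin_sub (N : ℕ) (v z : ZMod N → ℝ) (x : ℝ) :
    plin N (fun i => v i - z i) x = plin N v x - plin N z x := by
  unfold plin; ring

/-- Existence of the `L²` projection. -/
lemma exists_proj (N : ℕ) [NeZero N] (ψ : ℝ → ℝ) (hψ : Continuous ψ) :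
    ∃ v : ZMod N → ℝ, ∀ z : ZMod N → ℝ, ∫ x in (0 : ℝ)..1, (ψ x - plin N v x) * plin N z x = 0 := by
  have hN : (0 : ℝ) < N := Nat.cast_pos.2 (NeZero.pos N)
  have hc : ∀ v : ZMod N → ℝ, Continuous (plin N v) := plin_continuous N
  let L : (ZMod N → ℝ) →ₗ[ℝ] (ZMod N → ℝ) :=
    { toFun := fun v i => ∫ x in (0 : ℝ)..1, plin N v x * plin N (Pi.single i 1) x
      map_add' := by
        intro v z
        funext i
        simp only [Pi.add_apply]
        have c1 : ∀ z : ZMod N → ℝ, Continuous fun x => plin N z x * plin N (Pi.single i 1) x :=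
          fun z => (hc z).mul (hc _)
        rw [← integral_add ((c1 v).intervalIntegrable _ _) ((c1 z).intervalIntegrable _ _)]
        congr 1
        funext x
        have : plin N (v + z) x = plin N v x + plin N z x := by
          unfold plin; simp only [Pi.add_apply]; ring
        rw [this]; ring
      map_smul' := by
        intro c v
        funext i
        simp only [Pi.smul_apply, smul_eq_mul, RingHom.id_apply]
        rw [← intervalIntegral.integral_const_mul]
        congr 1
        funext x
        have : plin N (c • v) x = c * plin N v x := by
          unfold plin; simp only [Pi.smul_apply, smul_eq_mul]; ring
        rw [this]; ring }
  have hexp : ∀ (f : ℝ → ℝ), Continuous f → ∀ z : ZMod N → ℝ,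
      ∫ x in (0 : ℝ)..1, f x * plin N z x
        = ∑ i : ZMod N, z i * ∫ x in (0 : ℝ)..1, f x * plin N (Pi.single i 1) x := by
    intro f hf z
    have : ∀ x, f x * plin N z x = ∑ i : ZMod N, z i * (f x * plin N (Pi.single i 1) x) := by
      intro x
      rw [plin_eq_sum N z x, Finset.mul_sum]
      exact Finset.sum_congr rfl fun i _ => by ring
    simp_rw [this]
    rw [intervalIntegral.integral_finsetSum]
    · exact Finset.sum_congr rfl fun i _ => intervalIntegral.integral_const_mul _ _
    · intro i _
      exact (continuous_const.mul (hf.mul (hc _))).intervalIntegrable _ _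
  have hinj : Function.Injective L := by
    rw [← LinearMap.ker_eq_bot, LinearMap.ker_eq_bot']
    intro v hv
    have h1 : ∫ x in (0 : ℝ)..1, plin N v x * plin N v x = 0 := by
      rw [hexp _ (hc v) v]
      refine Finset.sum_eq_zero fun i _ => ?_
      have : L v i = 0 := by rw [hv]; rfl
      change ∫ x in (0 : ℝ)..1, plin N v x * plin N (Pi.single i 1) x = 0 at this
      rw [this, mul_zero]
    have h2 := plin_norm_lower N v
    simp_rw [sq] at h2
    rw [h1, mul_zero] at h2
    have h3 : ∑ i : ZMod N, v i * v i ≤ 0 := by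
      by_contra hcon
      push Not at hcon
      have : 0 < 1 / (N : ℝ) * ∑ i : ZMod N, v i * v i := by positivity
      linarith
    have h4 : ∑ i : ZMod N, v i * v i = 0 :=
      le_antisymm h3 (Finset.sum_nonneg fun i _ => mul_self_nonneg _)
    rw [Finset.sum_eq_zero_iff_of_nonneg fun i _ => mul_self_nonneg _] at h4
    funext i
    simpa using h4 i (Finset.mem_univ _)
  obtain ⟨v, hv⟩ := (LinearMap.injective_iff_surjective.1 hinj)
    (fun i => ∫ x in (0 : ℝ)..1, ψ x * plin N (Pi.single i 1) x)
  refine ⟨v, fun z => ?_⟩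
  simp_rw [sub_mul]
  have c1 : ∀ f : ℝ → ℝ, Continuous f → Continuous fun x => f x * plin N z x :=
    fun f hf => hf.mul (hc _)
  rw [integral_sub ((c1 ψ hψ).intervalIntegrable _ _)
    ((c1 _ (hc v)).intervalIntegrable _ _), hexp ψ hψ z, hexp _ (hc v) z, sub_eq_zero]
  refine Finset.sum_congr rfl fun i _ => ?_
  have := congrFun hv i
  change ∫ x in (0 : ℝ)..1, plin N v x * plin N (Pi.single i 1) x = _ at this
  rw [this]

lemma proj_summary (N : ℕ) [NeZero N] (ψ E e : ℝ → ℝ) (hp : ∀ x, ψ (x + 1) = ψ x)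
    (he : Continuous e) (hψ : ∀ x, HasDerivAt ψ (E x) x) (hEd : ∀ x, HasDerivAt E (e x) x) :
    ∃ v : ZMod N → ℝ,
      (∀ z : ZMod N → ℝ, ∫ x in (0 : ℝ)..1, (ψ x - plin N v x) * plin N z x = 0) ∧
      (∫ x in (0 : ℝ)..1, (ψ x - plin N v x) ^ 2 ≤ (1 / N) ^ 2 * ∫ x in (0 : ℝ)..1, E x ^ 2) ∧
      (∑ i : ZMod N, (v (i + 1) - v i) ^ 2 ≤ 36 * (1 / N) * ∫ x in (0 : ℝ)..1, E x ^ 2) ∧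
      (∑ i : ZMod N, (nodal N ψ i - v i) ^ 2 ≤ 3 * (1 / N) ^ 3 * ∫ x in (0 : ℝ)..1, e x ^ 2) := by
  have hN : (0 : ℝ) < N := Nat.cast_pos.2 (NeZero.pos N)
  have hE : Continuous E := continuous_iff_continuousAt.2 fun x => (hEd x).continuousAt
  have hψc : Continuous ψ := continuous_iff_continuousAt.2 fun x => (hψ x).continuousAt
  obtain ⟨v, hv⟩ := exists_proj N ψ hψc
  have hc : ∀ v : ZMod N → ℝ, Continuous (plin N v) := plin_continuous N
  set q : ZMod N → ℝ := fun i => nodal N ψ i - v i with hq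
  have pyth : ∫ x in (0 : ℝ)..1, (ψ x - plin N (nodal N ψ) x) ^ 2
      = (∫ x in (0 : ℝ)..1, (ψ x - plin N v x) ^ 2) + ∫ x in (0 : ℝ)..1, plin N q x ^ 2 := by
    have : ∀ x, (ψ x - plin N (nodal N ψ) x) ^ 2 = (ψ x - plin N v x) ^ 2 + (plin N q x ^ 2
        - 2 * ((ψ x - plin N v x) * plin N q x)) := by
      intro x
      rw [hq, plin_sub]
      ring
    simp_rw [this]
    have c1 : Continuous fun x => (ψ x - plin N v x) ^ 2 := (hψc.sub (hc _)).pow 2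
    have c2 : Continuous fun x => plin N q x ^ 2 := (hc _).pow 2
    have c3 : Continuous fun x => 2 * ((ψ x - plin N v x) * plin N q x) :=
      continuous_const.mul ((hψc.sub (hc _)).mul (hc _))
    have c4 : Continuous fun x => plin N q x ^ 2 - 2 * ((ψ x - plin N v x) * plin N q x) :=
      c2.sub c3
    rw [integral_add (c1.intervalIntegrable _ _) (c4.intervalIntegrable _ _),
      integral_sub (c2.intervalIntegrable _ _) (c3.intervalIntegrable _ _),
      intervalIntegral.integral_const_mul, hv q]
    ring
  have hr0 : 0 ≤ ∫ x in (0 : ℝ)..1, (ψ x - plin N v x) ^ 2 :=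
    integral_nonneg zero_le_one fun x _ => sq_nonneg _
  have hq0 : 0 ≤ ∫ x in (0 : ℝ)..1, plin N q x ^ 2 :=
    integral_nonneg zero_le_one fun x _ => sq_nonneg _
  have e1 := interp_err1 N ψ E hp hE hψ
  have e2 := interp_err2 N ψ E e hp he hψ hEd
  have hlow := plin_norm_lower N q
  have hsq : ∑ i : ZMod N, q i ^ 2 ≤ N * (3 * ∫ x in (0 : ℝ)..1, plin N q x ^ 2) := by
    rw [one_div, inv_mul_le_iff₀ hN] at hlow
    exact hlow
  refine ⟨v, hv, by linarith, ?_, ?_⟩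
  · have hd := nodal_diff_sq N ψ E hp hE hψ
    have h1 : ∑ i : ZMod N, (v (i + 1) - v i) ^ 2
        ≤ ∑ i : ZMod N, (2 * (nodal N ψ (i + 1) - nodal N ψ i) ^ 2 + 4 * q (i + 1) ^ 2
          + 4 * q i ^ 2) := by
      refine Finset.sum_le_sum fun i _ => ?_
      have : v (i + 1) - v i = (nodal N ψ (i + 1) - nodal N ψ i) - (q (i + 1) - q i) := by
        rw [hq]; ring
      rw [this]
      nlinarith [sq_nonneg ((nodal N ψ (i + 1) - nodal N ψ i) + (q (i + 1) - q i)),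
        sq_nonneg (q (i + 1) + q i)]
    rw [Finset.sum_add_distrib, Finset.sum_add_distrib, sum_shift N (fun i => 4 * q i ^ 2),
      ← Finset.mul_sum, ← Finset.mul_sum] at h1
    have h2 : ∑ i : ZMod N, q i ^ 2 ≤ N * (3 * ((1 / N) ^ 2 * ∫ x in (0 : ℝ)..1, E x ^ 2)) :=
      hsq.trans (by gcongr; linarith)
    have h3 : N * (3 * ((1 / (N : ℝ)) ^ 2 * ∫ x in (0 : ℝ)..1, E x ^ 2))
        = 3 * (1 / N * ∫ x in (0 : ℝ)..1, E x ^ 2) := by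
      field_simp
    rw [h3] at h2
    have h4 : 0 ≤ 1 / (N : ℝ) * ∫ x in (0 : ℝ)..1, E x ^ 2 :=
      mul_nonneg (by positivity) (integral_nonneg zero_le_one fun x _ => sq_nonneg _)
    linarith
  · have h2 : ∑ i : ZMod N, q i ^ 2 ≤ N * (3 * ((1 / N) ^ 4 * ∫ x in (0 : ℝ)..1, e x ^ 2)) :=
      hsq.trans (by gcongr; linarith)
    refine h2.trans (le_of_eq ?_)
    field_simp


/-! ### Maximum principles -/

lemma max_principle {X : Type*} [TopologicalSpace X] [CompactSpace X] (f : X → ℝ → ℝ) (T K : ℝ)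
    (hcont : ContinuousOn (fun p : X × ℝ => f p.1 p.2) (univ ×ˢ Icc (0 : ℝ) T))
    (h0 : ∀ x, f x 0 ≤ 0)
    (hd : ∀ x, ∀ t ∈ Ioc (0 : ℝ) T, 0 < f x t → (∀ y, f y t ≤ f x t) →
      ∃ f', HasDerivWithinAt (f x) f' (Icc (0 : ℝ) T) t ∧ f' ≤ K * f x t) :
    ∀ x, ∀ t ∈ Icc (0 : ℝ) T, f x t ≤ 0 := by
  intro x0 t0 ht0
  by_contra hpos
  push Not at hpos
  set F : X × ℝ → ℝ := fun p => Real.exp (-(K + 1) * p.2) * f p.1 p.2 with hF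
  have hFc : ContinuousOn F (univ ×ˢ Icc (0 : ℝ) T) := by
    refine ContinuousOn.mul ?_ hcont
    apply Continuous.continuousOn
    fun_prop
  obtain ⟨⟨x1, t1⟩, hm, hmax⟩ := (isCompact_univ.prod isCompact_Icc).exists_isMaxOn
    ⟨(x0, t0), ⟨mem_univ _, ht0⟩⟩ hFc
  have hmax' : ∀ y : X, ∀ s ∈ Icc (0 : ℝ) T, F (y, s) ≤ F (x1, t1) := fun y s hs =>
    hmax (show (y, s) ∈ univ ×ˢ Icc (0 : ℝ) T from ⟨mem_univ _, hs⟩)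
  have ht1 : t1 ∈ Icc (0 : ℝ) T := hm.2
  have hF0 : 0 < F (x0, t0) := mul_pos (Real.exp_pos _) hpos
  have hF1 : 0 < F (x1, t1) := hF0.trans_le (hmax' x0 t0 ht0)
  have hf1 : 0 < f x1 t1 := (pos_iff_pos_of_mul_pos hF1).1 (Real.exp_pos _)
  have ht1pos : 0 < t1 := by
    rcases ht1.1.lt_or_eq with h | h
    · exact h
    · rw [← h] at hf1
      exact absurd hf1 (not_lt.2 (h0 x1))
  obtain ⟨f', hf', hle⟩ := hd x1 t1 ⟨ht1pos, ht1.2⟩ hf1 (fun y => by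
    have := hmax' y t1 ht1
    exact le_of_mul_le_mul_left this (Real.exp_pos _))
  have hder : HasDerivWithinAt (fun s => F (x1, s))
      (Real.exp (-(K + 1) * t1) * (f' - (K + 1) * f x1 t1)) (Icc (0 : ℝ) T) t1 := by
    have h1 : HasDerivAt (fun s : ℝ => Real.exp (-(K + 1) * s))
        (Real.exp (-(K + 1) * t1) * (-(K + 1) * 1)) t1 :=
      ((hasDerivAt_id t1).const_mul (-(K + 1))).exp
    have := h1.hasDerivWithinAt.mul hf' (s := Icc (0 : ℝ) T)
    exact this.congr_deriv (by ring)
  have hloc : IsLocalMaxOn (fun s => F (x1, s)) (Icc (0 : ℝ) T) t1 := by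
    filter_upwards [self_mem_nhdsWithin] with s hs
    exact hmax' x1 s hs
  have hcone : (0 : ℝ) - t1 ∈ posTangentConeAt (Icc (0 : ℝ) T) t1 := by
    apply sub_mem_posTangentConeAt_of_segment_subset
    exact (convex_Icc (0 : ℝ) T).segment_subset ht1 ⟨le_rfl, ht1.1.trans ht1.2⟩
  have := hloc.hasFDerivWithinAt_nonpos hder.hasFDerivWithinAt hcone
  simp only [ContinuousLinearMap.toSpanSingleton_apply, smul_eq_mul] at this
  have hexp := Real.exp_pos (-(K + 1) * t1)
  have : Real.exp (-(K + 1) * t1) * (f' - (K + 1) * f x1 t1) < 0 :=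
    mul_neg_of_pos_of_neg hexp (by nlinarith)
  nlinarith

/-- Discrete maximum principle for the scheme. -/
lemma scheme_bound (N : ℕ) [NeZero N] (T h νhat U₀ : ℝ) (hh : 0 < h) (hT : 0 < T)
    (hν : U₀ * h / 2 ≤ νhat) (w w' : ℝ → ZMod N → ℝ)
    (hU : ∀ i, |w 0 i| ≤ U₀)
    (hw : ∀ i, ∀ t ∈ Icc (0 : ℝ) T,
        HasDerivWithinAt (fun s => w s i) (w' t i) (Icc (0 : ℝ) T) t)
    (hs : ∀ i, ∀ t ∈ Icc (0 : ℝ) T,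
        h * w' t i
          = -(1 / 6) * (w t (i + 1) ^ 2 + w t i * w t (i + 1)
              - w t i * w t (i - 1) - w t (i - 1) ^ 2)
            + νhat * ((w t (i + 1) - w t i) / h) - νhat * ((w t i - w t (i - 1)) / h)) :
    ∀ i, ∀ t ∈ Icc (0 : ℝ) T, |w t i| ≤ U₀ := by
  have hU0 : 0 ≤ U₀ := (abs_nonneg _).trans (hU 0)
  have hwc : ∀ i, ContinuousOn (fun s => w s i) (Icc (0 : ℝ) T) := fun i t ht =>
    (hw i t ht).continuousWithinAt
  have hbd : ∃ B : ℝ, ∀ i, ∀ t ∈ Icc (0 : ℝ) T, |w t i| ≤ B := by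
    choose B hB using fun i => isCompact_Icc.exists_bound_of_continuousOn (hwc i)
    refine ⟨∑ i, |B i|, fun i t ht => ?_⟩
    exact ((hB i t ht).trans (le_abs_self _)).trans
      (Finset.single_le_sum (f := fun i => |B i|) (fun i _ => abs_nonneg _) (Finset.mem_univ i))
  obtain ⟨B, hB⟩ := hbd
  let σ : Bool → ℝ := fun b => if b then 1 else -1
  have hσ : ∀ b, σ b = 1 ∨ σ b = -1 := by intro b; cases b <;> simp [σ]
  have key := max_principle (X := ZMod N × Bool)
    (fun p t => σ p.2 * w t p.1 - U₀) T (2 * B / h) ?_ ?_ ?_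
  · intro i t ht
    have h1 := key (i, true) t ht
    have h2 := key (i, false) t ht
    simp only [σ] at h1 h2
    rw [abs_le]
    constructor
    · simp at h2; linarith
    · simp at h1; linarith
  · rw [continuousOn_prod_of_discrete_left]
    intro p
    simp only [mem_prod, mem_univ, true_and]
    exact (continuousOn_const.mul (hwc p.1)).sub continuousOn_const
  · intro p
    have := abs_le.1 (hU p.1)
    rcases hσ p.2 with h | h <;> rw [h] <;> linarith [this.1, this.2]
  · rintro ⟨i, b⟩ t ht hpos hmax
    have htI : t ∈ Icc (0 : ℝ) T := ⟨ht.1.le, ht.2⟩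
    simp only at hpos hmax ⊢
    refine ⟨σ b * w' t i, ((hw i t htI).const_mul (σ b)).sub_const _, ?_⟩
    set V := σ b * w t i with hV
    have hall : ∀ j, |w t j| ≤ V := by
      intro j
      have h1 := hmax (j, true)
      have h2 := hmax (j, false)
      simp [σ] at h1 h2
      rw [abs_le]; constructor <;> linarith
    have hVB : V ≤ B := by
      have := abs_le.1 (hB i t htI)
      rcases hσ b with h | h <;> rw [hV, h] <;> linarith [this.1, this.2]
    have hσa : |σ b| = 1 := by rcases hσ b with h | h <;> rw [h] <;> simp
    set p := σ b * w t (i + 1) with hp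
    set m := σ b * w t (i - 1) with hm
    have hpl : p ≤ V ∧ -V ≤ p := by
      have : |p| ≤ V := by rw [hp, abs_mul, hσa, one_mul]; exact hall _
      exact ⟨(abs_le.1 this).2, (abs_le.1 this).1⟩
    have hml : m ≤ V ∧ -V ≤ m := by
      have : |m| ≤ V := by rw [hm, abs_mul, hσa, one_mul]; exact hall _
      exact ⟨(abs_le.1 this).2, (abs_le.1 this).1⟩
    set β := (w t (i + 1) + w t i + w t (i - 1)) / 6 with hβ
    have hβl : β ≤ V / 2 ∧ -(V / 2) ≤ β := by
      have h1 := abs_le.1 (hall (i + 1))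
      have h2 := abs_le.1 (hall i)
      have h3 := abs_le.1 (hall (i - 1))
      constructor <;> rw [hβ] <;> linarith [h1.1, h1.2, h2.1, h2.2, h3.1, h3.2]
    have heq : h * (σ b * w' t i) = (νhat / h - β) * (p - V) + (νhat / h + β) * (m - V) := by
      have : h * (σ b * w' t i) = σ b * (h * w' t i) := by ring
      rw [this, hs i t htI, hp, hm, hV, hβ]
      field_simp
      ring
    have hνh : U₀ / 2 ≤ νhat / h := by
      rw [le_div_iff₀ hh]; linarith
    have hVU : 0 < V - U₀ := hpos
    have t1 : (νhat / h - β) * (p - V) ≤ (V - U₀) * V := by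
      nlinarith [mul_nonneg (show 0 ≤ νhat / h - β + (V - U₀) / 2 by linarith [hβl.1])
        (show 0 ≤ V - p by linarith [hpl.1]), mul_nonneg hVU.le (show 0 ≤ V + p by linarith [hpl.2])]
    have t2 : (νhat / h + β) * (m - V) ≤ (V - U₀) * V := by
      nlinarith [mul_nonneg (show 0 ≤ νhat / h + β + (V - U₀) / 2 by linarith [hβl.2])
        (show 0 ≤ V - m by linarith [hml.1]), mul_nonneg hVU.le (show 0 ≤ V + m by linarith [hml.2])]
    have : 2 * B / h * (V - U₀) = (2 * B * (V - U₀)) / h := by ring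
    rw [this, le_div_iff₀ hh]
    nlinarith

set_option maxHeartbeats 800000 in
/-- One-sided slope bound for the scheme. -/
lemma scheme_slope (N : ℕ) [NeZero N] (T h νhat U₀ M : ℝ) (hh : 0 < h) (hT : 0 < T)
    (hν : U₀ * h / 2 ≤ νhat) (w w' : ℝ → ZMod N → ℝ) (hM : 0 ≤ M)
    (hU : ∀ i, ∀ t ∈ Icc (0 : ℝ) T, |w t i| ≤ U₀)
    (hw : ∀ i, ∀ t ∈ Icc (0 : ℝ) T,
        HasDerivWithinAt (fun s => w s i) (w' t i) (Icc (0 : ℝ) T) t)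
    (hs : ∀ i, ∀ t ∈ Icc (0 : ℝ) T,
        h * w' t i
          = -(1 / 6) * (w t (i + 1) ^ 2 + w t i * w t (i + 1)
              - w t i * w t (i - 1) - w t (i - 1) ^ 2)
            + νhat * ((w t (i + 1) - w t i) / h) - νhat * ((w t i - w t (i - 1)) / h))
    (h0 : ∀ i, (w 0 (i + 1) - w 0 i) / h ≤ M) :
    ∀ i, ∀ t ∈ Icc (0 : ℝ) T, (w t (i + 1) - w t i) / h ≤ M := by
  have hwc : ∀ i, ContinuousOn (fun s => w s i) (Icc (0 : ℝ) T) := fun i t ht =>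
    (hw i t ht).continuousWithinAt
  have key := max_principle (X := ZMod N)
    (fun i t => (w t (i + 1) - w t i) / h - M) T 0 ?_ ?_ ?_
  · intro i t ht
    have := key i t ht
    linarith
  · rw [continuousOn_prod_of_discrete_left]
    intro i
    simp only [mem_prod, mem_univ, true_and]
    exact (((hwc (i + 1)).sub (hwc i)).div_const h).sub continuousOn_const
  · intro i
    have := h0 i
    show (w 0 (i + 1) - w 0 i) / h - M ≤ 0
    linarith
  · intro i t ht hpos hmax
    have htI : t ∈ Icc (0 : ℝ) T := ⟨ht.1.le, ht.2⟩
    refine ⟨(w' t (i + 1) - w' t i) / h,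
      (((hw (i + 1) t htI).sub (hw i t htI)).div_const h).sub_const _, ?_⟩
    rw [zero_mul]
    refine div_nonpos_of_nonpos_of_nonneg ?_ hh.le
    have e1 := hs (i + 1) t htI
    have e2 := hs i t htI
    rw [add_sub_cancel_right] at e1
    have m1 := hmax (i + 1)
    have m2 := hmax (i - 1)
    rw [sub_add_cancel] at m2
    have u1 := abs_le.1 (hU i t htI)
    have u2 := abs_le.1 (hU (i + 1) t htI)
    set a := w t i
    set b := w t (i + 1)
    set c := w t (i + 1 + 1)
    set z := w t (i - 1)
    set Q := (b - a) / h with hQ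
    set α := Q - (c - b) / h with hα
    set β := Q - (a - z) / h with hβ
    have hb : b = a + h * Q := by rw [hQ]; field_simp; ring
    have hc : c = b + h * (Q - α) := by rw [hα]; field_simp; ring
    have hz : z = a - h * (Q - β) := by rw [hβ]; field_simp; ring
    have hα0 : 0 ≤ α := by rw [hα]; linarith
    have hβ0 : 0 ≤ β := by rw [hβ]; linarith
    have hQ0 : 0 < Q := by linarith
    have g1 : (c - b) / h = Q - α := by rw [hα]; ring
    have g2 : (a - z) / h = Q - β := by rw [hβ]; ring
    rw [g1] at e1
    rw [g2] at e2
    have hdiff : h * (w' t (i + 1) - w' t i) =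
        h * ((2 * a + h * Q) / 4 * (α - β)) - νhat * (α + β)
          - h ^ 2 * (Q ^ 2 - 7 / 12 * Q * (α + β) + (α ^ 2 + β ^ 2) / 6) := by
      rw [mul_sub, e1, e2, hc, hz, hb]
      ring
    have hmid : h * ((2 * a + h * Q) / 4 * (α - β)) - νhat * (α + β)
        ≤ - (h ^ 2 * Q / 4) * (α + β) := by
      have hν' : U₀ * h / 2 * (α + β) ≤ νhat * (α + β) := by gcongr
      have k1 : 0 ≤ h * (β * (U₀ + a)) := by
        have : 0 ≤ U₀ + a := by linarith [u1.1]
        positivity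
      have k2 : 0 ≤ h * (α * (U₀ - b)) := by
        have : 0 ≤ U₀ - b := by linarith [u2.2]
        positivity
      rw [hb] at k2
      nlinarith
    have hquad : 0 ≤ h ^ 2 * (Q ^ 2 - 1 / 3 * Q * (α + β) + (α ^ 2 + β ^ 2) / 6) := by
      apply mul_nonneg (by positivity)
      linarith [sq_nonneg (Q - α), sq_nonneg (Q - β), sq_nonneg Q]
    have : h * (w' t (i + 1) - w' t i) ≤ 0 := by
      rw [hdiff]; linarith
    by_contra hcon
    push Not at hcon
    nlinarith [mul_pos hh hcon]

/-- Second order necessary condition. -/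
lemma second_deriv_nonpos (f f' : ℝ → ℝ) (x f'' : ℝ) (hf : ∀ y, HasDerivAt f (f' y) y)
    (hf' : HasDerivAt f' f'' x) (hmax : IsLocalMax f x) : f' x = 0 ∧ f'' ≤ 0 := by
  have h1 : f' x = 0 := hmax.hasDerivAt_eq_zero (hf x)
  refine ⟨h1, ?_⟩
  by_contra hcon
  push Not at hcon
  have hfd : deriv f = f' := funext fun y => (hf y).deriv
  have hmin : IsLocalMin f x := by
    apply isLocalMin_of_deriv_deriv_pos
    · rw [hfd, hf'.deriv]; exact hcon
    · rw [hfd, h1]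
    · exact (hf x).continuousAt
  have hc : f =ᶠ[𝓝 x] fun _ => f x := by
    filter_upwards [hmax, hmin] with y h1 h2
    exact le_antisymm h1 h2
  have hd0 : f' =ᶠ[𝓝 x] fun _ => 0 := by
    rw [← hfd]
    have := hc.deriv
    filter_upwards [this] with y hy
    rw [hy]; simp
  have := hd0.deriv_eq
  rw [hf'.deriv, deriv_const] at this
  linarith

/-- One-sided Lipschitz bound for the Burgers solution. -/
lemma burgers_slope (T ν M : ℝ) (hT : 0 < T) (hν : 0 ≤ ν) (hM : 0 ≤ M) (u₀ : ℝ → ℝ)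
    (hu₀ : Differentiable ℝ u₀) (hu₀M : ∀ x, deriv u₀ x ≤ M)
    (u ux uxx ut : ℝ → ℝ → ℝ)
    (hper : ∀ x t, u (x + 1) t = u x t)
    (huc : Continuous fun p : ℝ × ℝ => u p.1 p.2)
    (hux : ∀ x t, HasDerivAt (fun y => u y t) (ux x t) x)
    (huxx : ∀ x t, HasDerivAt (fun y => ux y t) (uxx x t) x)
    (hut : ∀ x, ∀ t ∈ Icc (0 : ℝ) T,
        HasDerivWithinAt (fun s => u x s) (ut x t) (Icc (0 : ℝ) T) t)
    (hpde : ∀ x, ∀ t ∈ Ioc (0 : ℝ) T, ut x t + u x t * ux x t - ν * uxx x t = 0)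
    (hinit : ∀ x, u x 0 = u₀ x) :
    ∀ x, ∀ t ∈ Icc (0 : ℝ) T, ux x t ≤ M := by
  have key := max_principle (X := Icc (0 : ℝ) 1 × Icc (0 : ℝ) 1)
    (fun p t => u ((p.1 : ℝ) + (p.2 : ℝ)) t - u (p.1 : ℝ) t - M * (p.2 : ℝ)) T 0 ?_ ?_ ?_
  · have hlip : ∀ x, ∀ t ∈ Icc (0 : ℝ) T, ∀ l ∈ Icc (0 : ℝ) 1, u (x + l) t - u x t ≤ M * l := by
      intro x t ht l hl
      have hp1 : Function.Periodic (fun y => u y t) 1 := fun y => hper y t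
      have := key (⟨Int.fract x, Int.fract_nonneg _, (Int.fract_lt_one _).le⟩, ⟨l, hl⟩) t ht
      simp only at this
      have q1 : u (Int.fract x) t = u x t := by
        have := hp1.sub_zsmul_eq (x := x) ⌊x⌋
        simp only [zsmul_eq_mul, mul_one] at this
        rw [← Int.self_sub_floor]
        exact this
      have q2 : u (Int.fract x + l) t = u (x + l) t := by
        have := hp1.sub_zsmul_eq (x := x + l) ⌊x⌋
        simp only [zsmul_eq_mul, mul_one] at this
        rw [← this]
        rw [← Int.self_sub_floor]
        congr 1
        ring
      rw [q1, q2] at this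
      linarith
    intro x t ht
    have hd := (hux x t).hasDerivWithinAt (s := Ioi x)
    rw [hasDerivWithinAt_iff_tendsto_slope' (by simp)] at hd
    refine le_of_tendsto hd ?_
    have : Ioo x (x + 1) ∈ 𝓝[>] x := Ioo_mem_nhdsGT (by linarith)
    filter_upwards [this] with y hy
    rw [slope_def_field, div_le_iff₀ (by linarith [hy.1])]
    have := hlip x t ht (y - x) ⟨by linarith [hy.1], by linarith [hy.2]⟩
    rwa [add_sub_cancel] at this
  · apply Continuous.continuousOn
    have c1 : Continuous fun p : (Icc (0 : ℝ) 1 × Icc (0 : ℝ) 1) × ℝ =>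
        u ((p.1.1 : ℝ) + (p.1.2 : ℝ)) p.2 :=
      huc.comp (by fun_prop : Continuous fun p : (Icc (0 : ℝ) 1 × Icc (0 : ℝ) 1) × ℝ =>
        (((p.1.1 : ℝ) + (p.1.2 : ℝ)), p.2))
    have c2 : Continuous fun p : (Icc (0 : ℝ) 1 × Icc (0 : ℝ) 1) × ℝ => u ((p.1.1 : ℝ)) p.2 :=
      huc.comp (by fun_prop : Continuous fun p : (Icc (0 : ℝ) 1 × Icc (0 : ℝ) 1) × ℝ =>
        ((p.1.1 : ℝ), p.2))
    exact (c1.sub c2).sub (by fun_prop)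
  · rintro ⟨⟨x, hx⟩, ⟨l, hl⟩⟩
    simp only [hinit]
    have := image_sub_le_mul_sub_of_deriv_le hu₀ hu₀M (show x ≤ x + l by linarith [hl.1])
    rw [add_sub_cancel_left] at this
    linarith
  · rintro ⟨⟨x, hx⟩, ⟨l, hl⟩⟩ t ht hpos hmax
    simp only [] at hpos hmax ⊢
    have htI : t ∈ Icc (0 : ℝ) T := ⟨ht.1.le, ht.2⟩
    have hp1 : Function.Periodic (fun y => u y t) 1 := fun y => hper y t
    have hmaxall : ∀ x' l', l' ∈ Icc (0 : ℝ) 1 → u (x' + l') t - u x' t - M * l'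
        ≤ u (x + l) t - u x t - M * l := by
      intro x' l' hl'
      have := hmax (⟨Int.fract x', Int.fract_nonneg _, (Int.fract_lt_one _).le⟩, ⟨l', hl'⟩)
      simp only at this
      have q1 : u (Int.fract x') t = u x' t := by
        have := hp1.sub_zsmul_eq (x := x') ⌊x'⌋
        simp only [zsmul_eq_mul, mul_one] at this
        rw [← Int.self_sub_floor]
        exact this
      have q2 : u (Int.fract x' + l') t = u (x' + l') t := by
        have := hp1.sub_zsmul_eq (x := x' + l') ⌊x'⌋
        simp only [zsmul_eq_mul, mul_one] at this
        rw [← this]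
        rw [← Int.self_sub_floor]
        congr 1
        ring
      rw [q1, q2] at this
      exact this
    have hl0 : 0 < l := by
      rcases hl.1.lt_or_eq with h | h
      · exact h
      · rw [← h] at hpos; simp at hpos
    have hl1 : l < 1 := by
      rcases hl.2.lt_or_eq with h | h
      · exact h
      · rw [h, hper] at hpos; linarith
    have A := second_deriv_nonpos (fun y => u y t - M * y) (fun y => ux y t - M) (x + l)
      (uxx (x + l) t)
      (fun y => ((hux y t).sub ((hasDerivAt_id y).const_mul M)).congr_deriv (by ring))
      ((huxx (x + l) t).sub_const M) (by
        have : Ioo x (x + 1) ∈ 𝓝 (x + l) := Ioo_mem_nhds (by linarith) (by linarith)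
        filter_upwards [this] with y hy
        have := hmaxall x (y - x) ⟨by linarith [hy.1], by linarith [hy.2]⟩
        rw [add_sub_cancel] at this
        linarith)
    have B := second_deriv_nonpos (fun y => M * y - u y t) (fun y => M - ux y t) x
      (-uxx x t)
      (fun y => (((hasDerivAt_id y).const_mul M).sub (hux y t)).congr_deriv (by ring))
      ((huxx x t).const_sub M) (by
        have : Ioo (x + l - 1) (x + l) ∈ 𝓝 x := Ioo_mem_nhds (by linarith) (by linarith)
        filter_upwards [this] with y hy
        have := hmaxall y (x + l - y) ⟨by linarith [hy.2], by linarith [hy.1]⟩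
        rw [add_sub_cancel] at this
        linarith)
    refine ⟨ut (x + l) t - ut x t, ((hut (x + l) t htI).sub (hut x t htI)).sub_const _, ?_⟩
    have p1 := hpde (x + l) t ht
    have p2 := hpde x t ht
    have a1 : ux (x + l) t = M := by linarith [A.1]
    have b1 : ux x t = M := by linarith [B.1]
    rw [a1] at p1
    rw [b1] at p2
    have n1 : ν * uxx (x + l) t ≤ 0 := mul_nonpos_of_nonneg_of_nonpos hν A.2
    have n2 : 0 ≤ ν * uxx x t := mul_nonneg hν (by linarith [B.2])
    have : 0 ≤ M * (u (x + l) t - u x t) := mul_nonneg hM (by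
      have : 0 ≤ M * l := by positivity
      linarith)
    linarith


lemma plin_one_zero (N : ℕ) (v : ZMod N → ℝ) : plin N v 1 = plin N v 0 := by
  have := plin_periodic N v 0
  rwa [zero_add] at this

lemma static_L1 (ν : ℝ) (U Ux Uxx Ut ψ E e : ℝ → ℝ) (hUp : U 1 = U 0) (hUxp : Ux 1 = Ux 0)
    (hψp : ψ 1 = ψ 0) (hEp : E 1 = E 0)
    (hUxxc : Continuous Uxx) (hec : Continuous e)
    (hU : ∀ x, HasDerivAt U (Ux x) x) (hUx : ∀ x, HasDerivAt Ux (Uxx x) x)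
    (hψ : ∀ x, HasDerivAt ψ (E x) x) (hE : ∀ x, HasDerivAt E (e x) x)
    (hpde : ∀ x, Ut x + U x * Ux x - ν * Uxx x = 0) :
    ∫ x in (0 : ℝ)..1, Ut x * ψ x
      = (∫ x in (0 : ℝ)..1, U x ^ 2 / 2 * E x) + ν * ∫ x in (0 : ℝ)..1, U x * e x := by
  have cU : Continuous U := continuous_iff_continuousAt.2 fun x => (hU x).continuousAt
  have cUx : Continuous Ux := continuous_iff_continuousAt.2 fun x => (hUx x).continuousAt
  have cψ : Continuous ψ := continuous_iff_continuousAt.2 fun x => (hψ x).continuousAt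
  have cE : Continuous E := continuous_iff_continuousAt.2 fun x => (hE x).continuousAt
  have b1 := ibp_periodic (fun x => U x ^ 2 / 2) ψ (fun x => U x * Ux x) E (by fun_prop) cψ
    (fun x => ((((hU x).pow 2).div_const 2).congr_deriv (by simp; ring)).hasDerivWithinAt)
    (fun x => (hψ x).hasDerivWithinAt) ((cU.mul cUx).intervalIntegrable _ _)
    (cE.intervalIntegrable _ _) (by simp only [hUp]) hψp
  have b2 := ibp_periodic Ux ψ Uxx E cUx cψ (fun x => (hUx x).hasDerivWithinAt)
    (fun x => (hψ x).hasDerivWithinAt) (hUxxc.intervalIntegrable _ _)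
    (cE.intervalIntegrable _ _) hUxp hψp
  have b3 := ibp_periodic U E Ux e cU cE (fun x => (hU x).hasDerivWithinAt)
    (fun x => (hE x).hasDerivWithinAt) (cUx.intervalIntegrable _ _)
    (hec.intervalIntegrable _ _) hUp hEp
  have e1 : ∀ x, Ut x * ψ x = ν * (Uxx x * ψ x) - U x * Ux x * ψ x := by
    intro x
    have : Ut x = ν * Uxx x - U x * Ux x := by linarith [hpde x]
    rw [this]; ring
  simp only [e1]
  have c1 : Continuous fun x => ν * (Uxx x * ψ x) := by fun_prop
  have c2 : Continuous fun x => U x * Ux x * ψ x := by fun_prop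
  rw [intervalIntegral.integral_sub (c1.intervalIntegrable _ _) (c2.intervalIntegrable _ _),
    intervalIntegral.integral_const_mul, b1, b2, b3]
  ring

lemma static_L2 (N : ℕ) [NeZero N] (w : ZMod N → ℝ) (D₀ : ℝ) (U Ux E e : ℝ → ℝ) (hUp : U 1 = U 0)
    (hEp : E 1 = E 0) (hUxc : Continuous Ux) (hec : Continuous e)
    (hU : ∀ x, HasDerivAt U (Ux x) x)
    (hE : ∀ x, HasDerivAt E (e x) x)
    (hD : ∀ x, (Ux x + pconst N w x) / 2 ≤ D₀) :
    - ∫ x in (0 : ℝ)..1, (U x + plin N w x) / 2 * e x * E x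
      ≤ 1 / 2 * (D₀ * ∫ x in (0 : ℝ)..1, E x ^ 2) := by
  have cU : Continuous U := continuous_iff_continuousAt.2 fun x => (hU x).continuousAt
  have cE : Continuous E := continuous_iff_continuousAt.2 fun x => (hE x).continuousAt
  have cp := plin_continuous N w
  have ip := pconst_intervalIntegrable N w 0 1
  have ia : IntervalIntegrable (fun x => (Ux x + pconst N w x) / 2) volume 0 1 :=
    ((hUxc.intervalIntegrable _ _).add ip).div_const 2
  have ia1 : IntervalIntegrable (fun x => (Ux x + pconst N w x) / 2 * E x) volume 0 1 :=
    ia.mul_continuousOn cE.continuousOn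
  have ia2 : IntervalIntegrable (fun x => (Ux x + pconst N w x) / 2 * E x * E x) volume 0 1 :=
    ia1.mul_continuousOn cE.continuousOn
  have cae : Continuous fun x => (U x + plin N w x) / 2 * e x := by fun_prop
  have cae2 : Continuous fun x => (U x + plin N w x) / 2 * e x * E x := by fun_prop
  have b1 := ibp_periodic (fun x => (U x + plin N w x) / 2 * E x) E
    (fun x => (Ux x + pconst N w x) / 2 * E x + (U x + plin N w x) / 2 * e x) e
    (by fun_prop) cE
    (fun x => ((((hU x).hasDerivWithinAt.add (plin_hasDeriv_right N w x)).div_const 2).mul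
      (hE x).hasDerivWithinAt))
    (fun x => (hE x).hasDerivWithinAt) (ia1.add (cae.intervalIntegrable _ _))
    (hec.intervalIntegrable _ _) (by simp only [hUp, hEp, plin_one_zero]) hEp
  have b2 : ∫ x in (0 : ℝ)..1, ((Ux x + pconst N w x) / 2 * E x + (U x + plin N w x) / 2 * e x) * E x
      = (∫ x in (0 : ℝ)..1, (Ux x + pconst N w x) / 2 * E x * E x)
        + ∫ x in (0 : ℝ)..1, (U x + plin N w x) / 2 * e x * E x := by
    rw [← intervalIntegral.integral_add ia2 (cae2.intervalIntegrable _ _)]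
    congr 1; funext x; ring
  have b3 : ∫ x in (0 : ℝ)..1, (U x + plin N w x) / 2 * E x * e x
      = ∫ x in (0 : ℝ)..1, (U x + plin N w x) / 2 * e x * E x := by
    congr 1; funext x; ring
  rw [b2, b3] at b1
  have cE2 : Continuous fun x => D₀ * E x ^ 2 := by fun_prop
  have b4 : ∫ x in (0 : ℝ)..1, (Ux x + pconst N w x) / 2 * E x * E x
      ≤ ∫ x in (0 : ℝ)..1, D₀ * E x ^ 2 := by
    apply intervalIntegral.integral_mono zero_le_one ia2 (cE2.intervalIntegrable _ _)
    intro x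
    have := mul_le_mul_of_nonneg_right (hD x) (sq_nonneg (E x))
    simp only
    linarith
  rw [intervalIntegral.integral_const_mul] at b4
  linarith

lemma static_L3 (N : ℕ) [NeZero N] (w : ZMod N → ℝ) (ψ E : ℝ → ℝ) (hψp : ψ 1 = ψ 0)
    (cE : Continuous E) (hψ : ∀ x, HasDerivAt ψ (E x) x) :
    ∫ x in (0 : ℝ)..1, plin N w x ^ 2 / 2 * E x
      = - ∫ x in (0 : ℝ)..1, plin N w x * pconst N w x * ψ x := by
  have cψ : Continuous ψ := continuous_iff_continuousAt.2 fun x => (hψ x).continuousAt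
  have cp := plin_continuous N w
  have ip := pconst_intervalIntegrable N w 0 1
  have b1 := ibp_periodic (fun x => plin N w x ^ 2 / 2) ψ (fun x => plin N w x * pconst N w x) E
    (by fun_prop) cψ
    (fun x => ((((plin_hasDeriv_right N w x).pow 2).div_const 2).congr_deriv (by simp; ring)))
    (fun x => (hψ x).hasDerivWithinAt) (ip.continuousOn_mul cp.continuousOn)
    (cE.intervalIntegrable _ _) (by simp only [plin_one_zero]) hψp
  rw [b1, neg_neg]

lemma sum_by_parts (N : ℕ) [NeZero N] (d v : ZMod N → ℝ) :
    ∑ i : ZMod N, (d i - d (i - 1)) * v i = - ∑ i : ZMod N, d i * (v (i + 1) - v i) := by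
  have := sum_shift N fun i => d (i - 1) * v i
  simp only [add_sub_cancel_right] at this
  simp only [sub_mul, mul_sub, Finset.sum_sub_distrib]
  rw [this]; ring

lemma static_L4 (N : ℕ) [NeZero N] (w : ZMod N → ℝ) (ψ E e : ℝ → ℝ)
    (hp : ∀ x, ψ (x + 1) = ψ x) (hEp : E 1 = E 0)
    (hec : Continuous e) (hψ : ∀ x, HasDerivAt ψ (E x) x) (hE : ∀ x, HasDerivAt E (e x) x) :
    ∫ x in (0 : ℝ)..1, plin N w x * e x
      = ∑ i : ZMod N, (N * (w (i + 1) - w i) - N * (w i - w (i - 1))) * nodal N ψ i := by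
  have cE : Continuous E := continuous_iff_continuousAt.2 fun x => (hE x).continuousAt
  have cp := plin_continuous N w
  have ip := pconst_intervalIntegrable N w 0 1
  have b1 := ibp_periodic (plin N w) E (pconst N w) e cp cE (plin_hasDeriv_right N w)
    (fun x => (hE x).hasDerivWithinAt) ip
    (hec.intervalIntegrable _ _) (plin_one_zero N w) hEp
  rw [integral_pconst_mul N w ψ E hp cE hψ] at b1
  have := sum_by_parts N (fun i => N * (w (i + 1) - w i)) (nodal N ψ)
  simp only [sub_add_cancel] at this
  rw [this]
  linarith

lemma lump_diff (N : ℕ) [NeZero N] (z v : ZMod N → ℝ) :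
    (∫ x in (0 : ℝ)..1, plin N z x * plin N v x) - 1 / N * ∑ i, z i * v i
      = - (1 / N / 6) * ∑ i : ZMod N, (z (i + 1) - z i) * (v (i + 1) - v i) := by
  rw [integral_plin_mul]
  have := sum_shift N fun i => z i * v i
  have e : ∑ i : ZMod N, (z i * v i / 3 + z (i + 1) * v (i + 1) / 3
          + z i * v (i + 1) / 6 + z (i + 1) * v i / 6)
      = 1 / 2 * ∑ i : ZMod N, z i * v i + 1 / 2 * ∑ i : ZMod N, z (i + 1) * v (i + 1)
        - 1 / 6 * ∑ i : ZMod N, (z (i + 1) - z i) * (v (i + 1) - v i) := by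
    simp only [Finset.mul_sum, ← Finset.sum_add_distrib, ← Finset.sum_sub_distrib]
    refine Finset.sum_congr rfl fun i _ => ?_
    ring
  rw [e, this]
  ring


lemma le_of_sq_le_mul {x y : ℝ} (hy : 0 ≤ y) (h : x ^ 2 ≤ y ^ 2) : x ≤ y :=
  (le_abs_self x).trans (abs_le_of_sq_le_sq h hy)

set_option maxHeartbeats 1600000 in
/-- The residual identity and bound at a fixed time. -/
lemma static_est (N : ℕ) [NeZero N] (h : ℝ) (hh : h = 1 / N) (ν νhat U₀ D₀ : ℝ)
    (hν0 : 0 ≤ ν) (hνν : ν ≤ νhat) (hνU : νhat - ν ≤ U₀ * h / 2) (hU₀ : 0 ≤ U₀)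
    (U Ux Uxx Ut ψ E e : ℝ → ℝ) (w w' : ZMod N → ℝ)
    (hUp : U 1 = U 0) (hUxp : Ux 1 = Ux 0)
    (hψp : ∀ x, ψ (x + 1) = ψ x) (hEp : E 1 = E 0)
    (hUxxc : Continuous Uxx) (hUtc : Continuous Ut)
    (hU : ∀ x, HasDerivAt U (Ux x) x) (hUx : ∀ x, HasDerivAt Ux (Uxx x) x)
    (hψ : ∀ x, HasDerivAt ψ (E x) x) (hE : ∀ x, HasDerivAt E (e x) x)
    (he : ∀ x, e x = U x - plin N w x)
    (hpde : ∀ x, Ut x + U x * Ux x - ν * Uxx x = 0)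
    (hD : ∀ x, (Ux x + pconst N w x) / 2 ≤ D₀)
    (hs : ∀ i, h * w' i
          = -(1 / 6) * (w (i + 1) ^ 2 + w i * w (i + 1)
              - w i * w (i - 1) - w (i - 1) ^ 2)
            + νhat * ((w (i + 1) - w i) / h) - νhat * ((w i - w (i - 1)) / h))
    (z : ZMod N → ℝ) :
    -(2 * ∫ x in (0 : ℝ)..1, (Ut x - plin N w' x) * ψ x)
      ≤ D₀ * (∫ x in (0 : ℝ)..1, E x ^ 2)
        + 2 * √(∫ x in (0 : ℝ)..1, E x ^ 2) *
          (h * √(∫ x in (0 : ℝ)..1, (plin N z x + plin N w x * pconst N w x) ^ 2)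
            + 6 * √(h * U₀) * √(h * ∑ i : ZMod N, max 0 (νhat - ν) * ((w (i + 1) - w i) / h) ^ 2)
            + h ^ 2 * √(h * ∑ i : ZMod N, ((w' (i + 1) - w' i) / h) ^ 2))
        + 3 / 2 * h ^ 3 * (ν * ∑ i : ZMod N,
            ((w (i + 1) - w i) / h - (w i - w (i - 1)) / h) ^ 2) := by
  have hN : (0 : ℝ) < N := by exact_mod_cast NeZero.pos N
  have hh0 : 0 < h := by rw [hh]; positivity
  have hdiv : ∀ a : ℝ, a / h = N * a := by intro a; rw [hh]; field_simp
  have cU : Continuous U := continuous_iff_continuousAt.2 fun x => (hU x).continuousAt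
  have cUx : Continuous Ux := continuous_iff_continuousAt.2 fun x => (hUx x).continuousAt
  have cψ : Continuous ψ := continuous_iff_continuousAt.2 fun x => (hψ x).continuousAt
  have cE : Continuous E := continuous_iff_continuousAt.2 fun x => (hE x).continuousAt
  have cp := plin_continuous N w
  have cp' := plin_continuous N w'
  have cz := plin_continuous N z
  have ip := pconst_intervalIntegrable N w 0 1
  have ipp : IntervalIntegrable (fun x => plin N w x * pconst N w x) volume 0 1 :=
    ip.continuousOn_mul cp.continuousOn
  have ce : Continuous e := by
    have : e = fun x => U x - plin N w x := funext he
    rw [this]; fun_prop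
  have hψ10 : ψ 1 = ψ 0 := by simpa using hψp 0
  obtain ⟨v, hv0, hv1, hv2, hv3⟩ := proj_summary N ψ E e hψp ce hψ hE
  rw [← hh] at hv1 hv2 hv3
  have cv := plin_continuous N v
  set G := ∫ x in (0 : ℝ)..1, E x ^ 2 with hG
  have hG0 : 0 ≤ G := intervalIntegral.integral_nonneg zero_le_one fun x _ => sq_nonneg _
  set J : ZMod N → ℝ := fun i => (w (i + 1) - w i) / h - (w i - w (i - 1)) / h with hJ
  set d : ZMod N → ℝ := fun i => (w (i + 1) - w i) / h with hd
  -- identity 1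
  have L1 := static_L1 ν U Ux Uxx Ut ψ E e hUp hUxp hψ10 hEp hUxxc ce hU hUx hψ hE hpde
  have L2 := static_L2 N w D₀ U Ux E e hUp hEp cUx ce hU hE hD
  have L3 := static_L3 N w ψ E hψ10 cE hψ
  have L4 : ∫ x in (0 : ℝ)..1, plin N w x * e x = ∑ i, J i * nodal N ψ i := by
    rw [static_L4 N w ψ E e hψp hEp ce hψ hE]
    simp only [hJ, hdiv]
  have S1 : ∫ x in (0 : ℝ)..1, (Ut x - plin N w' x) * ψ x
      = (∫ x in (0 : ℝ)..1, Ut x * ψ x) - ∫ x in (0 : ℝ)..1, plin N w' x * ψ x := by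
    have c1 : Continuous fun x => Ut x * ψ x := by fun_prop
    have c2 : Continuous fun x => plin N w' x * ψ x := by fun_prop
    rw [← intervalIntegral.integral_sub (c1.intervalIntegrable _ _) (c2.intervalIntegrable _ _)]
    congr 1; funext x; ring
  have S2 : ∫ x in (0 : ℝ)..1, U x ^ 2 / 2 * E x
      = (∫ x in (0 : ℝ)..1, (U x + plin N w x) / 2 * e x * E x)
        + ∫ x in (0 : ℝ)..1, plin N w x ^ 2 / 2 * E x := by
    have c1 : Continuous fun x => (U x + plin N w x) / 2 * e x * E x := by fun_prop
    have c2 : Continuous fun x => plin N w x ^ 2 / 2 * E x := by fun_prop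
    rw [← intervalIntegral.integral_add (c1.intervalIntegrable _ _) (c2.intervalIntegrable _ _)]
    congr 1; funext x; rw [he]; ring
  have S3 : ∫ x in (0 : ℝ)..1, U x * e x
      = (∫ x in (0 : ℝ)..1, e x ^ 2) + ∫ x in (0 : ℝ)..1, plin N w x * e x := by
    have c1 : Continuous fun x => e x ^ 2 := by fun_prop
    have c2 : Continuous fun x => plin N w x * e x := by fun_prop
    rw [← intervalIntegral.integral_add (c1.intervalIntegrable _ _) (c2.intervalIntegrable _ _)]
    congr 1; funext x
    have : U x = e x + plin N w x := by rw [he]; ring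
    rw [this]; ring
  have S4 : ∫ x in (0 : ℝ)..1, plin N w' x * ψ x = ∫ x in (0 : ℝ)..1, plin N w' x * plin N v x := by
    have c1 : Continuous fun x => plin N w' x * ψ x := by fun_prop
    have c2 : Continuous fun x => plin N w' x * plin N v x := by fun_prop
    have := hv0 w'
    rw [← sub_eq_zero, ← intervalIntegral.integral_sub (c1.intervalIntegrable _ _)
      (c2.intervalIntegrable _ _), ← this]
    congr 1; funext x; ring
  have crv : Continuous fun x => ψ x - plin N v x := by fun_prop
  have ires : IntervalIntegrable (fun x => plin N z x + plin N w x * pconst N w x) volume 0 1 :=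
    (cz.intervalIntegrable _ _).add ipp
  have S5 : ∫ x in (0 : ℝ)..1, plin N w x * pconst N w x * ψ x
      = (∫ x in (0 : ℝ)..1, plin N w x * pconst N w x * plin N v x)
        + ∫ x in (0 : ℝ)..1, (plin N z x + plin N w x * pconst N w x) * (ψ x - plin N v x) := by
    have i1 : IntervalIntegrable (fun x => plin N w x * pconst N w x * plin N v x) volume 0 1 :=
      ipp.mul_continuousOn cv.continuousOn
    have i2 : IntervalIntegrable (fun x => plin N w x * pconst N w x * (ψ x - plin N v x))
        volume 0 1 := ipp.mul_continuousOn crv.continuousOn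
    have c3 : Continuous fun x => (ψ x - plin N v x) * plin N z x := by fun_prop
    have : ∫ x in (0 : ℝ)..1, (plin N z x + plin N w x * pconst N w x) * (ψ x - plin N v x)
        = (∫ x in (0 : ℝ)..1, (ψ x - plin N v x) * plin N z x)
          + ∫ x in (0 : ℝ)..1, plin N w x * pconst N w x * (ψ x - plin N v x) := by
      rw [← intervalIntegral.integral_add (c3.intervalIntegrable _ _) i2]
      congr 1; funext x; ring
    rw [this, hv0 z, zero_add, ← intervalIntegral.integral_add i1 i2]
    congr 1; funext x; ring
  have S6 : ∫ x in (0 : ℝ)..1, plin N w x * pconst N w x * plin N v x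
      = νhat * ∑ i, J i * v i - h * ∑ i, w' i * v i := by
    rw [integral_conv, Finset.mul_sum, Finset.mul_sum, ← Finset.sum_sub_distrib]
    refine Finset.sum_congr rfl fun i _ => ?_
    have : h * (w' i * v i) = h * w' i * v i := by ring
    rw [this, hs i, hJ]
    ring
  have S7 := lump_diff N w' v
  rw [← hh] at S7
  have S8 : ∑ i, J i * v i = - ∑ i, d i * (v (i + 1) - v i) := by
    have := sum_by_parts N d v
    simp only [hd, sub_add_cancel] at this
    simp only [hJ, hd]
    exact this
  have S9 : ∑ i, J i * nodal N ψ i = ∑ i, J i * v i + ∑ i, J i * (nodal N ψ i - v i) := by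
    rw [← Finset.sum_add_distrib]
    refine Finset.sum_congr rfl fun i _ => ?_
    ring
  -- bounds
  set Δv2 := ∑ i : ZMod N, (v (i + 1) - v i) ^ 2 with hΔv2
  have hsG : √G ^ 2 = G := Real.sq_sqrt hG0
  -- I1
  have B1 : -(h / 6) * ∑ i : ZMod N, (w' (i + 1) - w' i) * (v (i + 1) - v i)
      ≤ √G * (h ^ 2 * √(h * ∑ i : ZMod N, ((w' (i + 1) - w' i) / h) ^ 2)) := by
    apply le_of_sq_le_mul (by positivity)
    have cs := Finset.sum_mul_sq_le_sq_mul_sq Finset.univ (fun i : ZMod N => w' (i + 1) - w' i)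
      (fun i => v (i + 1) - v i)
    have q : h * ∑ i : ZMod N, ((w' (i + 1) - w' i) / h) ^ 2
        = (∑ i : ZMod N, (w' (i + 1) - w' i) ^ 2) / h := by
      have : ∀ i : ZMod N, ((w' (i + 1) - w' i) / h) ^ 2 = (w' (i + 1) - w' i) ^ 2 / h ^ 2 :=
        fun i => div_pow _ _ _
      simp only [this, ← Finset.sum_div]
      field_simp
    have q0 : 0 ≤ ∑ i : ZMod N, (w' (i + 1) - w' i) ^ 2 := Finset.sum_nonneg fun i _ => sq_nonneg _
    rw [mul_pow, mul_pow, mul_pow, hsG, Real.sq_sqrt (by rw [q]; positivity), q]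
    have r1 : (-(h / 6)) ^ 2 * (∑ i : ZMod N, (w' (i + 1) - w' i) * (v (i + 1) - v i)) ^ 2
        ≤ (-(h / 6)) ^ 2 * ((∑ i : ZMod N, (w' (i + 1) - w' i) ^ 2) * (36 * h * G)) :=
      mul_le_mul_of_nonneg_left (cs.trans (mul_le_mul_of_nonneg_left hv2 q0)) (sq_nonneg _)
    refine r1.trans (le_of_eq ?_)
    generalize (∑ i : ZMod N, (w' (i + 1) - w' i) ^ 2) = X
    field_simp
    ring
  -- I2
  have B2 : ∫ x in (0 : ℝ)..1, (plin N z x + plin N w x * pconst N w x) * (ψ x - plin N v x)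
      ≤ √G * (h * √(∫ x in (0 : ℝ)..1, (plin N z x + plin N w x * pconst N w x) ^ 2)) := by
    have i1 : IntervalIntegrable (fun x => (plin N z x + plin N w x * pconst N w x) ^ 2)
        volume 0 1 := by
      have j1 : Continuous fun x => plin N z x ^ 2 := by fun_prop
      have j2 : IntervalIntegrable (fun x => (2 * plin N z x * plin N w x) * pconst N w x)
        volume 0 1 := ip.continuousOn_mul (by fun_prop)
      have j3 : IntervalIntegrable (fun x => pconst N w x * pconst N w x) volume 0 1 := by
        rw [intervalIntegrable_iff_integrableOn_Ioc_of_le zero_le_one] at ip ⊢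
        refine Integrable.mul_bdd (c := ∑ i : ZMod N, |(N : ℝ) * (w (i + 1) - w i)|) ip
          (pconst_measurable N w).aestronglyMeasurable ?_
        refine Eventually.of_forall fun x => ?_
        exact Finset.single_le_sum (f := fun i : ZMod N => |(N : ℝ) * (w (i + 1) - w i)|)
          (fun i _ => abs_nonneg _) (Finset.mem_univ ((⌊x * (N : ℝ)⌋ : ℤ) : ZMod N))
      have j4 : IntervalIntegrable (fun x => plin N w x ^ 2 * (pconst N w x * pconst N w x))
        volume 0 1 := j3.continuousOn_mul (by fun_prop)
      have := ((j1.intervalIntegrable 0 1).add j2).add j4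
      refine this.congr fun x _ => ?_
      show plin N z x ^ 2 + (2 * plin N z x * plin N w x) * pconst N w x + plin N w x ^ 2 * (pconst N w x * pconst N w x) = (plin N z x + plin N w x * pconst N w x) ^ 2
      ring
    have c2 : Continuous fun x => (ψ x - plin N v x) ^ 2 := by fun_prop
    have cs := cs_integral_sqrt (fun x => plin N z x + plin N w x * pconst N w x)
      (fun x => ψ x - plin N v x) 0 1 zero_le_one i1 (c2.intervalIntegrable _ _)
      (ires.mul_continuousOn crv.continuousOn)
    refine (le_abs_self _).trans (cs.trans ?_)
    have : √(∫ x in (0 : ℝ)..1, (ψ x - plin N v x) ^ 2) ≤ h * √G := by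
      rw [Real.sqrt_le_left (by positivity), mul_pow, hsG]
      exact hv1
    calc _ ≤ √(∫ x in (0 : ℝ)..1, (plin N z x + plin N w x * pconst N w x) ^ 2) * (h * √G) :=
          mul_le_mul_of_nonneg_left this (Real.sqrt_nonneg _)
      _ = _ := by ring
  -- I3
  have hmax : max 0 (νhat - ν) = νhat - ν := max_eq_right (by linarith)
  have B3 : -((νhat - ν) * ∑ i, d i * (v (i + 1) - v i))
      ≤ √G * (6 * √(h * U₀) * √(h * ∑ i : ZMod N, max 0 (νhat - ν) * d i ^ 2)) := by
    apply le_of_sq_le_mul (by positivity)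
    have cs := Finset.sum_mul_sq_le_sq_mul_sq Finset.univ d (fun i => v (i + 1) - v i)
    have q0 : 0 ≤ ∑ i : ZMod N, d i ^ 2 := Finset.sum_nonneg fun i _ => sq_nonneg _
    have κ0 : 0 ≤ νhat - ν := by linarith
    rw [hmax, ← Finset.mul_sum]
    rw [mul_pow, mul_pow, mul_pow, hsG, Real.sq_sqrt (by positivity), Real.sq_sqrt (by positivity)]
    have r1 : (νhat - ν) ^ 2 * (∑ i, d i * (v (i + 1) - v i)) ^ 2
        ≤ (νhat - ν) ^ 2 * ((∑ i, d i ^ 2) * (36 * h * G)) :=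
      mul_le_mul_of_nonneg_left (cs.trans (mul_le_mul_of_nonneg_left hv2 q0)) (sq_nonneg _)
    have r2 : (νhat - ν) * ((νhat - ν) * ((∑ i, d i ^ 2) * (36 * h * G)))
        ≤ (U₀ * h) * ((νhat - ν) * ((∑ i, d i ^ 2) * (36 * h * G))) := by
      apply mul_le_mul_of_nonneg_right _ (by positivity)
      have : 0 ≤ U₀ * h := by positivity
      linarith
    linarith
  -- I4
  have B4 : -(∑ i, J i * (nodal N ψ i - v i))
      ≤ (∫ x in (0 : ℝ)..1, e x ^ 2) + 3 / 4 * h ^ 3 * ∑ i, J i ^ 2 := by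
    have r : ∀ i, -(J i * (nodal N ψ i - v i))
        ≤ 3 / 4 * h ^ 3 * J i ^ 2 + 1 / (3 * h ^ 3) * (nodal N ψ i - v i) ^ 2 := by
      intro i
      set r := nodal N ψ i - v i
      have : 0 ≤ 1 / (3 * h ^ 3) * (3 / 2 * h ^ 3 * J i + r) ^ 2 := by positivity
      have e : 1 / (3 * h ^ 3) * (3 / 2 * h ^ 3 * J i + r) ^ 2
          = 3 / 4 * h ^ 3 * J i ^ 2 + J i * r + 1 / (3 * h ^ 3) * r ^ 2 := by
        field_simp
        ring
      linarith
    have s := Finset.sum_le_sum fun i (_ : i ∈ Finset.univ) => r i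
    rw [Finset.sum_neg_distrib, Finset.sum_add_distrib, ← Finset.mul_sum, ← Finset.mul_sum] at s
    have : 1 / (3 * h ^ 3) * ∑ i : ZMod N, (nodal N ψ i - v i) ^ 2
        ≤ ∫ x in (0 : ℝ)..1, e x ^ 2 := by
      rw [one_div, inv_mul_le_iff₀ (by positivity)]
      exact hv3
    linarith
  have B4' := mul_le_mul_of_nonneg_left B4 hν0
  rw [S1, L1, S2, L3, S3, L4, S4, S5, S6, S9, S8]
  rw [S8] at S9
  nlinarith [B1, B2, B3, B4', L2, S7]


lemma gronwall_sqrt (T D₀ : ℝ) (hT : 0 < T) (hD : 0 ≤ D₀) (g g' A B : ℝ → ℝ)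
    (hg0 : ∀ t, 0 ≤ g t) (hgc : Continuous g)
    (hd : ∀ t ∈ Ioo (0 : ℝ) T, HasDerivAt g (g' t) t)
    (hA0 : ∀ t, 0 ≤ A t) (hB0 : ∀ t, 0 ≤ B t)
    (hle : ∀ t ∈ Ioo (0 : ℝ) T, g' t ≤ D₀ * g t + 2 * √(g t) * A t + B t)
    (hAi : IntervalIntegrable A volume 0 T) (hBi : IntervalIntegrable B volume 0 T) :
    √(g T) ≤ Real.exp (D₀ * T) *
      (√(g 0) + √(∫ t in (0 : ℝ)..T, B t) + 2 * ∫ t in (0 : ℝ)..T, A t) := by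
  set k : ℝ → ℝ := fun t => Real.exp (-D₀ * t) * g t with hk
  have hkc : Continuous k := by fun_prop
  have hk0 : ∀ t, 0 ≤ k t := fun t => mul_nonneg (Real.exp_pos _).le (hg0 t)
  obtain ⟨ts, hts, hmax⟩ := isCompact_Icc.exists_isMaxOn (nonempty_Icc.2 hT.le) hkc.continuousOn
  have hmax' : ∀ t ∈ Icc (0 : ℝ) T, k t ≤ k ts := fun t ht => hmax ht
  set Mx := √(k ts) with hMx
  have hMx2 : Mx ^ 2 = k ts := Real.sq_sqrt (hk0 ts)
  have hMx0 : 0 ≤ Mx := Real.sqrt_nonneg _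
  set a := ∫ t in (0 : ℝ)..T, A t with ha
  set b := ∫ t in (0 : ℝ)..T, B t with hb
  have ha0 : 0 ≤ a := intervalIntegral.integral_nonneg hT.le fun t _ => hA0 t
  have hb0 : 0 ≤ b := intervalIntegral.integral_nonneg hT.le fun t _ => hB0 t
  have hi : IntervalIntegrable (fun t => 2 * Mx * A t + B t) volume 0 T :=
    (hAi.const_mul (2 * Mx)).add hBi
  have hkd : ∀ t ∈ Ioo (0 : ℝ) T, HasDerivAt k (Real.exp (-D₀ * t) * (g' t - D₀ * g t)) t := by
    intro t ht
    have h1 : HasDerivAt (fun s : ℝ => Real.exp (-D₀ * s))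
        (Real.exp (-D₀ * t) * (-D₀ * 1)) t :=
      ((hasDerivAt_id t).const_mul (-D₀)).exp
    exact (h1.mul (hd t ht)).congr_deriv (by ring)
  have hkle : ∀ t ∈ Ioo (0 : ℝ) T, Real.exp (-D₀ * t) * (g' t - D₀ * g t)
      ≤ 2 * Mx * A t + B t := by
    intro t ht
    have hx0 := Real.exp_pos (-D₀ * t)
    have hx1 : Real.exp (-D₀ * t) ≤ 1 := by
      apply Real.exp_le_one_iff.2
      have := mul_nonneg hD ht.1.le
      linarith
    have h1 : Real.exp (-D₀ * t) * √(g t) ≤ Mx := by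
      apply Real.le_sqrt_of_sq_le
      rw [mul_pow, Real.sq_sqrt (hg0 t)]
      refine le_trans ?_ (hmax' t ⟨ht.1.le, ht.2.le⟩)
      rw [hk]
      apply mul_le_mul_of_nonneg_right _ (hg0 t)
      nlinarith
    calc Real.exp (-D₀ * t) * (g' t - D₀ * g t)
        ≤ Real.exp (-D₀ * t) * (2 * √(g t) * A t + B t) :=
          mul_le_mul_of_nonneg_left (by linarith [hle t ht]) hx0.le
      _ = 2 * (Real.exp (-D₀ * t) * √(g t)) * A t + Real.exp (-D₀ * t) * B t := by ring
      _ ≤ 2 * Mx * A t + 1 * B t := by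
          apply add_le_add
          · exact mul_le_mul_of_nonneg_right (by linarith) (hA0 t)
          · exact mul_le_mul_of_nonneg_right hx1 (hB0 t)
      _ = _ := by ring
  have hmain : k ts - k 0 ≤ ∫ t in (0 : ℝ)..ts, (2 * Mx * A t + B t) := by
    apply intervalIntegral.sub_le_integral_of_hasDeriv_right_of_le hts.1 hkc.continuousOn
      (g' := fun t => Real.exp (-D₀ * t) * (g' t - D₀ * g t))
    · intro t ht
      exact (hkd t ⟨ht.1, ht.2.trans_le hts.2⟩).hasDerivWithinAt
    · rw [intervalIntegrable_iff_integrableOn_Icc_of_le hT.le] at hi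
      exact hi.mono_set (Icc_subset_Icc_right hts.2)
    · intro t ht
      exact hkle t ⟨ht.1, ht.2.trans_le hts.2⟩
  have hext : ∫ t in (0 : ℝ)..ts, (2 * Mx * A t + B t) ≤ ∫ t in (0 : ℝ)..T, (2 * Mx * A t + B t) := by
    apply intervalIntegral.integral_mono_interval le_rfl hts.1 hts.2 _ hi
    refine Eventually.of_forall fun t => ?_
    have := hA0 t
    have := hB0 t
    show 0 ≤ 2 * Mx * A t + B t
    positivity
  rw [intervalIntegral.integral_add (hAi.const_mul (2 * Mx)) hBi,
    intervalIntegral.integral_const_mul] at hext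
  have hk00 : k 0 = g 0 := by simp [hk]
  rw [hk00, ← hMx2] at hmain
  have s0 := Real.sq_sqrt (hg0 0)
  have sb := Real.sq_sqrt hb0
  have n0 := Real.sqrt_nonneg (g 0)
  have nb := Real.sqrt_nonneg b
  have hq : Mx ≤ √(g 0) + √b + 2 * a := by
    have : Mx - a ≤ √(g 0) + √b + a := by
      apply le_of_sq_le_mul (by positivity)
      nlinarith [mul_nonneg n0 nb, mul_nonneg n0 ha0, mul_nonneg nb ha0]
    linarith
  have hfin : √(g T) ≤ Real.exp (D₀ * T) * Mx := by
    rw [Real.sqrt_le_left (by positivity), mul_pow, hMx2]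
    have h1 : g T = Real.exp (D₀ * T) * k T := by
      rw [hk]; simp only
      rw [← mul_assoc, ← Real.exp_add]; simp
    have hx1 : 1 ≤ Real.exp (D₀ * T) := Real.one_le_exp (mul_nonneg hD hT.le)
    have h2 := hmax' T ⟨hT.le, le_rfl⟩
    rw [h1]
    calc Real.exp (D₀ * T) * k T ≤ Real.exp (D₀ * T) * k ts :=
          mul_le_mul_of_nonneg_left h2 (by positivity)
      _ ≤ Real.exp (D₀ * T) ^ 2 * k ts := by
          apply mul_le_mul_of_nonneg_right _ (hk0 ts)
          nlinarith
  exact hfin.trans (mul_le_mul_of_nonneg_left hq (Real.exp_pos _).le)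

lemma param_deriv (T : ℝ) (a b : ℝ) (f f' : ℝ → ℝ → ℝ)
    (hf : Continuous fun p : ℝ × ℝ => f p.1 p.2) (hf' : Continuous fun p : ℝ × ℝ => f' p.1 p.2)
    (hd : ∀ x, ∀ t ∈ Ioo (0 : ℝ) T, HasDerivAt (fun s => f x s) (f' x t) t) :
    ∀ t ∈ Ioo (0 : ℝ) T,
      HasDerivAt (fun s => ∫ x in a..b, f x s) (∫ x in a..b, f' x t) t := by
  intro t ht
  have cf : ∀ s, Continuous fun x => f x s := fun s =>
    hf.comp (by fun_prop : Continuous fun x : ℝ => (x, s))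
  have cf' : ∀ s, Continuous fun x => f' x s := fun s =>
    hf'.comp (by fun_prop : Continuous fun x : ℝ => (x, s))
  obtain ⟨M, hM⟩ := (isCompact_uIcc.prod isCompact_Icc).exists_bound_of_continuousOn
    (s := uIcc a b ×ˢ Icc (0 : ℝ) T) hf'.continuousOn
  have := intervalIntegral.hasDerivAt_integral_of_dominated_loc_of_deriv_le (μ := volume)
    (F := fun s x => f x s) (F' := fun s x => f' x s) (x₀ := t) (a := a) (b := b)
    (s := Ioo 0 T) (bound := fun _ => M) (Ioo_mem_nhds ht.1 ht.2)
    (Eventually.of_forall fun s => (cf s).aestronglyMeasurable)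
    ((cf t).intervalIntegrable _ _) (cf' t).aestronglyMeasurable
    (Eventually.of_forall fun x hx s hs => hM (x, s) ⟨uIoc_subset_uIcc hx, hs.1.le, hs.2.le⟩)
    (intervalIntegrable_const) (Eventually.of_forall fun x hx s hs => hd x s hs)
  exact this.2

/-- The mean-zero primitive in space. -/
noncomputable def prim (f : ℝ → ℝ → ℝ) (x t : ℝ) : ℝ :=
  (∫ y in (0 : ℝ)..x, f y t) - ∫ z in (0 : ℝ)..1, ∫ y in (0 : ℝ)..z, f y t

lemma cont_prim0 (f : ℝ → ℝ → ℝ) (hf : Continuous fun p : ℝ × ℝ => f p.1 p.2) :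
    Continuous fun p : ℝ × ℝ => ∫ y in (0 : ℝ)..p.1, f y p.2 := by
  have h1 : Continuous (Function.uncurry fun t x : ℝ => f x t) :=
    hf.comp (by fun_prop : Continuous fun p : ℝ × ℝ => (p.2, p.1))
  have h2 := intervalIntegral.continuous_parametric_primitive_of_continuous (μ := volume)
    (a₀ := (0 : ℝ)) h1
  exact h2.comp (by fun_prop : Continuous fun p : ℝ × ℝ => (p.2, p.1))

lemma cont_int01 (f : ℝ → ℝ → ℝ) (hf : Continuous fun p : ℝ × ℝ => f p.1 p.2) :
    Continuous fun t : ℝ => ∫ y in (0 : ℝ)..1, f y t :=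
  (cont_prim0 f hf).comp (by fun_prop : Continuous fun t : ℝ => ((1 : ℝ), t))

lemma prim_cont (f : ℝ → ℝ → ℝ) (hf : Continuous fun p : ℝ × ℝ => f p.1 p.2) :
    Continuous fun p : ℝ × ℝ => prim f p.1 p.2 := by
  have h1 := cont_prim0 f hf
  have h2 := cont_int01 (fun z t => ∫ y in (0 : ℝ)..z, f y t) h1
  exact h1.sub (h2.comp continuous_snd)

lemma prim_deriv_x (f : ℝ → ℝ → ℝ) (hf : Continuous fun p : ℝ × ℝ => f p.1 p.2) (x t : ℝ) :
    HasDerivAt (fun y => prim f y t) (f x t) x := by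
  have cf : Continuous fun x => f x t := hf.comp (by fun_prop : Continuous fun x : ℝ => (x, t))
  exact (cf.integral_hasStrictDerivAt 0 x).hasDerivAt.sub_const _

lemma prim_deriv_t (T : ℝ) (f f' : ℝ → ℝ → ℝ) (hf : Continuous fun p : ℝ × ℝ => f p.1 p.2)
    (hf' : Continuous fun p : ℝ × ℝ => f' p.1 p.2)
    (hd : ∀ x, ∀ t ∈ Ioo (0 : ℝ) T, HasDerivAt (fun s => f x s) (f' x t) t) :
    ∀ x, ∀ t ∈ Ioo (0 : ℝ) T, HasDerivAt (fun s => prim f x s) (prim f' x t) t := by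
  intro x t ht
  have h1 : ∀ x, ∀ t ∈ Ioo (0 : ℝ) T, HasDerivAt (fun s => ∫ y in (0 : ℝ)..x, f y s)
      (∫ y in (0 : ℝ)..x, f' y t) t := fun x => param_deriv T 0 x f f' hf hf' hd
  exact (h1 x t ht).sub (param_deriv T 0 1 (fun z s => ∫ y in (0 : ℝ)..z, f y s)
    (fun z s => ∫ y in (0 : ℝ)..z, f' y s) (cont_prim0 f hf) (cont_prim0 f' hf') h1 t ht)

lemma prim_mean (f : ℝ → ℝ → ℝ) (hf : Continuous fun p : ℝ × ℝ => f p.1 p.2) (t : ℝ) :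
    ∫ x in (0 : ℝ)..1, prim f x t = 0 := by
  have c1 : Continuous fun x => ∫ y in (0 : ℝ)..x, f y t :=
    (cont_prim0 f hf).comp (by fun_prop : Continuous fun x : ℝ => (x, t))
  unfold prim
  rw [intervalIntegral.integral_sub (c1.intervalIntegrable _ _) intervalIntegrable_const,
    intervalIntegral.integral_const]
  simp

lemma periodic_primitive (q : ℝ → ℝ) (hq : Continuous q) (hp : ∀ x, q (x + 1) = q x)
    (h0 : ∫ x in (0 : ℝ)..1, q x = 0) (x : ℝ) :
    ∫ y in (0 : ℝ)..(x + 1), q y = ∫ y in (0 : ℝ)..x, q y := by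
  have hp1 : Function.Periodic q 1 := hp
  have := hp1.intervalIntegral_add_eq x 0
  rw [zero_add, h0] at this
  rw [← intervalIntegral.integral_add_adjacent_intervals (hq.intervalIntegrable 0 x)
    (hq.intervalIntegrable x (x + 1)), this, add_zero]

lemma prim_periodic (f : ℝ → ℝ → ℝ) (hf : Continuous fun p : ℝ × ℝ => f p.1 p.2) (t : ℝ)
    (hp : ∀ x, f (x + 1) t = f x t) (h0 : ∫ x in (0 : ℝ)..1, f x t = 0) (x : ℝ) :
    prim f (x + 1) t = prim f x t := by
  have cf : Continuous fun x => f x t := hf.comp (by fun_prop : Continuous fun x : ℝ => (x, t))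
  unfold prim
  rw [periodic_primitive (fun x => f x t) cf hp h0 x]

lemma prim_one_zero (f : ℝ → ℝ → ℝ) (t : ℝ) (h0 : ∫ x in (0 : ℝ)..1, f x t = 0) :
    prim f 1 t = prim f 0 t := by
  unfold prim
  rw [h0]; simp

lemma plin_joint (N : ℕ) [NeZero N] (W : ℝ → ZMod N → ℝ) (hW : ∀ i, Continuous fun t => W t i) :
    Continuous fun p : ℝ × ℝ => plin N (W p.2) p.1 := by
  simp_rw [fun p : ℝ × ℝ => plin_eq_sum N (W p.2) p.1]
  refine continuous_finset_sum _ fun i _ => ?_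
  exact ((hW i).comp continuous_snd).mul ((plin_continuous N _).comp continuous_fst)

lemma plin_deriv_t (N : ℕ) [NeZero N] (W : ℝ → ZMod N → ℝ) (W' : ZMod N → ℝ) (x t : ℝ)
    (hW : ∀ i, HasDerivAt (fun s => W s i) (W' i) t) :
    HasDerivAt (fun s => plin N (W s) x) (plin N W' x) t := by
  simp_rw [fun s : ℝ => plin_eq_sum N (W s) x, plin_eq_sum N W' x]
  exact HasDerivAt.fun_sum fun i _ => (hW i).mul_const _


/-- The projection residual. -/
noncomputable def resinf (N : ℕ) (w : ZMod N → ℝ) : ℝ :=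
  ⨅ v : ZMod N → ℝ, √(∫ x in (0 : ℝ)..1, (plin N v x + plin N w x * pconst N w x) ^ 2)

lemma resinf_nonneg (N : ℕ) (w : ZMod N → ℝ) : 0 ≤ resinf N w :=
  Real.iInf_nonneg fun _ => Real.sqrt_nonneg _

lemma resinf_bdd (N : ℕ) (w : ZMod N → ℝ) : BddBelow (range fun v : ZMod N → ℝ =>
    √(∫ x in (0 : ℝ)..1, (plin N v x + plin N w x * pconst N w x) ^ 2)) :=
  ⟨0, by rintro _ ⟨v, rfl⟩; exact Real.sqrt_nonneg _⟩

lemma res_cont (N : ℕ) [NeZero N] (W : ℝ → ZMod N → ℝ) (hW : ∀ i, Continuous fun t => W t i)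
    (v : ZMod N → ℝ) : Continuous fun t =>
      √(∫ x in (0 : ℝ)..1, (plin N v x + plin N (W t) x * pconst N (W t) x) ^ 2) := by
  simp_rw [integral_res_sq]
  apply Real.continuous_sqrt.comp
  refine continuous_const.mul (continuous_finset_sum _ fun i _ => ?_)
  have h1 := hW i
  have h2 := hW (i + 1)
  fun_prop

lemma resinf_integrable (N : ℕ) [NeZero N] (W : ℝ → ZMod N → ℝ)
    (hW : ∀ i, Continuous fun t => W t i) (a b : ℝ) :
    IntervalIntegrable (fun t => resinf N (W t)) volume a b := by
  have hm : Measurable fun t => resinf N (W t) := by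
    apply UpperSemicontinuous.measurable
    exact upperSemicontinuous_ciInf (fun t => resinf_bdd N (W t))
      (fun v => (res_cont N W hW v).upperSemicontinuous)
  refine ((res_cont N W hW 0).intervalIntegrable a b).mono_fun hm.aestronglyMeasurable ?_
  refine Eventually.of_forall fun t => ?_
  beta_reduce
  rw [Real.norm_of_nonneg (resinf_nonneg _ _), Real.norm_of_nonneg (Real.sqrt_nonneg _)]
  exact ciInf_le (resinf_bdd N (W t)) 0

lemma const_of_deriv_zero (T : ℝ) (f : ℝ → ℝ) (hf : Continuous f)
    (hd : ∀ t ∈ Ioo (0 : ℝ) T, HasDerivAt f 0 t) : ∀ t ∈ Icc (0 : ℝ) T, f t = f 0 := by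
  intro t ht
  have := intervalIntegral.integral_eq_sub_of_hasDerivAt_of_le (f := f) (f' := fun _ => 0) ht.1
    hf.continuousOn (fun s hs => hd s ⟨hs.1, hs.2.trans_le ht.2⟩) intervalIntegrable_const
  simp at this
  linarith

lemma filter_est (δ : ℝ) (hδ : 0 < δ) (p E e : ℝ → ℝ) (hp : ContDiff ℝ 2 p)
    (hper : ∀ x, p (x + 1) = p x) (hEp : E 1 = E 0) (hec : Continuous e)
    (hE : ∀ x, HasDerivAt E (e x) x)
    (heq : ∀ x, -δ ^ 2 * iteratedDeriv 2 p x + p x = e x) :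
    √(δ ^ 2 * (∫ x in (0 : ℝ)..1, deriv p x ^ 2) + ∫ x in (0 : ℝ)..1, p x ^ 2)
      ≤ √(∫ x in (0 : ℝ)..1, E x ^ 2) / δ := by
  have cE : Continuous E := continuous_iff_continuousAt.2 fun x => (hE x).continuousAt
  have cp : Continuous p := hp.continuous
  have hp' : ContDiff ℝ 1 (deriv p) := by
    have : ContDiff ℝ (1 + 1) p := by norm_num; exact hp
    exact (contDiff_succ_iff_deriv.1 this).2.2
  have cdp : Continuous (deriv p) := hp'.continuous
  have d1 : ∀ x, HasDerivAt p (deriv p x) x := fun x =>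
    (hp.differentiable (by norm_num) x).hasDerivAt
  have d2 : ∀ x, HasDerivAt (deriv p) (iteratedDeriv 2 p x) x := fun x => by
    have := (hp'.differentiable (by norm_num) x).hasDerivAt
    rw [iteratedDeriv_succ, iteratedDeriv_one]
    exact this
  have cddp : Continuous (iteratedDeriv 2 p) := hp.continuous_iteratedDeriv 2 le_rfl
  have p10 : p 1 = p 0 := by simpa using hper 0
  have dp10 : deriv p 1 = deriv p 0 := by
    have h1 : HasDerivAt (fun x => p (x + 1)) (deriv p 1) 0 := by
      have := (d1 (0 + 1)).comp_add_const 0 1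
      simpa using this
    have h2 : (fun x => p (x + 1)) = p := funext hper
    rw [h2] at h1
    exact h1.unique (d1 0)
  have b1 := ibp_periodic (deriv p) p (iteratedDeriv 2 p) (deriv p) cdp cp
    (fun x => (d2 x).hasDerivWithinAt) (fun x => (d1 x).hasDerivWithinAt)
    (cddp.intervalIntegrable _ _) (cdp.intervalIntegrable _ _) dp10 p10
  have b2 := ibp_periodic E p e (deriv p) cE cp
    (fun x => (hE x).hasDerivWithinAt) (fun x => (d1 x).hasDerivWithinAt)
    (hec.intervalIntegrable _ _) (cdp.intervalIntegrable _ _) hEp p10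
  set Y := δ ^ 2 * (∫ x in (0 : ℝ)..1, deriv p x ^ 2) + ∫ x in (0 : ℝ)..1, p x ^ 2 with hY
  have n1 : 0 ≤ ∫ x in (0 : ℝ)..1, deriv p x ^ 2 :=
    intervalIntegral.integral_nonneg zero_le_one fun x _ => sq_nonneg _
  have n2 : 0 ≤ ∫ x in (0 : ℝ)..1, p x ^ 2 :=
    intervalIntegral.integral_nonneg zero_le_one fun x _ => sq_nonneg _
  have n3 : 0 ≤ ∫ x in (0 : ℝ)..1, E x ^ 2 :=
    intervalIntegral.integral_nonneg zero_le_one fun x _ => sq_nonneg _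
  have hY1 : Y = ∫ x in (0 : ℝ)..1, e x * p x := by
    have e1 : ∀ x, e x * p x = -δ ^ 2 * (iteratedDeriv 2 p x * p x) + p x ^ 2 := by
      intro x; rw [← heq x]; ring
    simp only [e1]
    have c1 : Continuous fun x => -δ ^ 2 * (iteratedDeriv 2 p x * p x) := by fun_prop
    have c2 : Continuous fun x => p x ^ 2 := by fun_prop
    rw [intervalIntegral.integral_add (c1.intervalIntegrable _ _) (c2.intervalIntegrable _ _),
      intervalIntegral.integral_const_mul, b1, hY]
    simp only [sq]
    ring
  have c1 : Continuous fun x => E x ^ 2 := by fun_prop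
  have c2 : Continuous fun x => deriv p x ^ 2 := by fun_prop
  have c3 : Continuous fun x => E x * deriv p x := by fun_prop
  have cs := cs_integral E (deriv p) 0 1 zero_le_one (c1.intervalIntegrable _ _)
    (c2.intervalIntegrable _ _) (c3.intervalIntegrable _ _)
  have hY2 : Y ^ 2 ≤ (∫ x in (0 : ℝ)..1, E x ^ 2) * ∫ x in (0 : ℝ)..1, deriv p x ^ 2 := by
    rw [hY1, b2, neg_sq]; exact cs
  have hY0 : 0 ≤ Y := by positivity
  have hδY : δ ^ 2 * (∫ x in (0 : ℝ)..1, deriv p x ^ 2) ≤ Y := by rw [hY]; linarith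
  rw [le_div_iff₀ hδ]
  apply Real.le_sqrt_of_sq_le
  rw [mul_pow, Real.sq_sqrt hY0]
  rcases hY0.lt_or_eq with hpos | h0
  · have : Y * (Y * δ ^ 2) ≤ Y * ∫ x in (0 : ℝ)..1, E x ^ 2 := by
      have := mul_le_mul_of_nonneg_left hδY n3
      nlinarith [mul_le_mul_of_nonneg_right hY2 (sq_nonneg δ)]
    exact le_of_mul_le_mul_left this hpos
  · rw [← h0, zero_mul]; exact n3

lemma init_est (N : ℕ) [NeZero N] (e ψ E : ℝ → ℝ) (hp : ∀ x, ψ (x + 1) = ψ x)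
    (hec : Continuous e) (hEp : E 1 = E 0)
    (hψ : ∀ x, HasDerivAt ψ (E x) x) (hE : ∀ x, HasDerivAt E (e x) x)
    (horth : ∀ v : ZMod N → ℝ, ∫ x in (0 : ℝ)..1, e x * plin N v x = 0) :
    √(∫ x in (0 : ℝ)..1, E x ^ 2) ≤ 1 / N * √(∫ x in (0 : ℝ)..1, e x ^ 2) := by
  have cE : Continuous E := continuous_iff_continuousAt.2 fun x => (hE x).continuousAt
  have cψ : Continuous ψ := continuous_iff_continuousAt.2 fun x => (hψ x).continuousAt
  have ψ10 : ψ 1 = ψ 0 := by simpa using hp 0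
  have b := ibp_periodic E ψ e E cE cψ (fun x => (hE x).hasDerivWithinAt)
    (fun x => (hψ x).hasDerivWithinAt) (hec.intervalIntegrable _ _)
    (cE.intervalIntegrable _ _) hEp ψ10
  have cpl := plin_continuous N (nodal N ψ)
  have h1 : ∫ x in (0 : ℝ)..1, e x * (ψ x - plin N (nodal N ψ) x)
      = ∫ x in (0 : ℝ)..1, e x * ψ x := by
    have c1 : Continuous fun x => e x * ψ x := by fun_prop
    have c2 : Continuous fun x => e x * plin N (nodal N ψ) x := by fun_prop
    have e1 : ∀ x, e x * (ψ x - plin N (nodal N ψ) x)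
        = e x * ψ x - e x * plin N (nodal N ψ) x := fun x => by ring
    simp only [e1]
    rw [intervalIntegral.integral_sub (c1.intervalIntegrable _ _) (c2.intervalIntegrable _ _),
      horth (nodal N ψ), sub_zero]
  have c1 : Continuous fun x => e x ^ 2 := by fun_prop
  have c2 : Continuous fun x => (ψ x - plin N (nodal N ψ) x) ^ 2 := by fun_prop
  have c3 : Continuous fun x => e x * (ψ x - plin N (nodal N ψ) x) := by fun_prop
  have cs := cs_integral e (fun x => ψ x - plin N (nodal N ψ) x) 0 1 zero_le_one
    (c1.intervalIntegrable _ _) (c2.intervalIntegrable _ _) (c3.intervalIntegrable _ _)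
  have ie := interp_err1 N ψ E hp cE hψ
  rw [h1, b] at cs
  have e2 : ∫ x in (0 : ℝ)..1, E x * E x = ∫ x in (0 : ℝ)..1, E x ^ 2 := by simp only [sq]
  rw [e2, neg_sq] at cs
  set Y := ∫ x in (0 : ℝ)..1, E x ^ 2
  set Z := ∫ x in (0 : ℝ)..1, e x ^ 2
  have hY0 : 0 ≤ Y := intervalIntegral.integral_nonneg zero_le_one fun x _ => sq_nonneg _
  have hZ0 : 0 ≤ Z := intervalIntegral.integral_nonneg zero_le_one fun x _ => sq_nonneg _
  rw [Real.sqrt_le_left (by positivity), mul_pow, Real.sq_sqrt hZ0]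
  rcases hY0.lt_or_eq with hpos | h0
  · have : Y * Y ≤ Y * ((1 / N) ^ 2 * Z) := by
      have := mul_le_mul_of_nonneg_left ie hZ0
      nlinarith
    exact le_of_mul_le_mul_left this hpos
  · rw [← h0]; positivity


lemma periodic_deriv (f f' : ℝ → ℝ) (hp : ∀ x, f (x + 1) = f x) (hd : ∀ x, HasDerivAt f (f' x) x)
    (x : ℝ) : f' (x + 1) = f' x := by
  have h1 : HasDerivAt (fun x => f (x + 1)) (f' (x + 1)) x := (hd (x + 1)).comp_add_const x 1
  have h2 : (fun x => f (x + 1)) = f := funext hp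
  rw [h2] at h1
  exact h1.unique (hd x)

lemma int_ut_zero (ν : ℝ) (U Ux Uxx Ut : ℝ → ℝ) (hUp : U 1 = U 0) (hUxp : Ux 1 = Ux 0)
    (hUxxc : Continuous Uxx)
    (hU : ∀ x, HasDerivAt U (Ux x) x) (hUx : ∀ x, HasDerivAt Ux (Uxx x) x)
    (hpde : ∀ x, Ut x + U x * Ux x - ν * Uxx x = 0) :
    ∫ x in (0 : ℝ)..1, Ut x = 0 := by
  have cU : Continuous U := continuous_iff_continuousAt.2 fun x => (hU x).continuousAt
  have cUx : Continuous Ux := continuous_iff_continuousAt.2 fun x => (hUx x).continuousAt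
  have e1 : ∀ x, Ut x = ν * Uxx x - U x * Ux x := fun x => by linarith [hpde x]
  simp only [e1]
  have c : Continuous fun x => ν * Uxx x - U x * Ux x := by fun_prop
  rw [intervalIntegral.integral_eq_sub_of_hasDerivAt (f := fun x => ν * Ux x - U x ^ 2 / 2)
    (fun x _ => (((hUx x).const_mul ν).sub (((hU x).pow 2).div_const 2)).congr_deriv
      (by simp; ring)) (c.intervalIntegrable _ _), hUp, hUxp, sub_self]

lemma sum_w'_zero (N : ℕ) [NeZero N] (h νhat : ℝ) (hh : 0 < h) (w w' : ZMod N → ℝ)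
    (hs : ∀ i, h * w' i
          = -(1 / 6) * (w (i + 1) ^ 2 + w i * w (i + 1)
              - w i * w (i - 1) - w (i - 1) ^ 2)
            + νhat * ((w (i + 1) - w i) / h) - νhat * ((w i - w (i - 1)) / h)) :
    ∑ i, w' i = 0 := by
  set F : ZMod N → ℝ := fun i => -(1 / 6) * (w i ^ 2 + w i * w (i - 1) + w (i - 1) ^ 2)
    + νhat * ((w i - w (i - 1)) / h) with hF
  have e : ∀ i, h * w' i = F (i + 1) - F i := by
    intro i
    rw [hs i, hF]; simp only [add_sub_cancel_right]; ring
  have : h * ∑ i, w' i = 0 := by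
    rw [Finset.mul_sum]
    simp only [e, Finset.sum_sub_distrib]
    rw [sum_shift N F, sub_self]
  exact (mul_eq_zero.1 this).resolve_left hh.ne'

lemma plin_const_one (N : ℕ) (x : ℝ) : plin N (fun _ => 1) x = 1 := by
  unfold plin; simp

set_option maxHeartbeats 1600000 in
lemma dynamic (N : ℕ) [NeZero N] (h : ℝ) (hh : h = 1 / N) (T ν νhat U₀ D₀ : ℝ) (hT : 0 < T)
    (hν0 : 0 ≤ ν) (hνν : ν ≤ νhat) (hνU : νhat - ν ≤ U₀ * h / 2) (hU₀ : 0 ≤ U₀) (hD₀ : 0 ≤ D₀)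
    (u ux uxx ut : ℝ → ℝ → ℝ) (W W' : ℝ → ZMod N → ℝ)
    (hper : ∀ x t, u (x + 1) t = u x t)
    (huc : Continuous fun p : ℝ × ℝ => u p.1 p.2)
    (huxxc : Continuous fun p : ℝ × ℝ => uxx p.1 p.2)
    (hutc : Continuous fun p : ℝ × ℝ => ut p.1 p.2)
    (hux : ∀ x t, HasDerivAt (fun y => u y t) (ux x t) x)
    (huxx : ∀ x t, HasDerivAt (fun y => ux y t) (uxx x t) x)
    (hut : ∀ x, ∀ t ∈ Ioo (0 : ℝ) T, HasDerivAt (fun s => u x s) (ut x t) t)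
    (hpde : ∀ x, ∀ t ∈ Ioo (0 : ℝ) T, ut x t + u x t * ux x t - ν * uxx x t = 0)
    (hWc : ∀ i, Continuous fun t => W t i) (hW'c : ∀ i, Continuous fun t => W' t i)
    (hWd : ∀ i, ∀ t ∈ Ioo (0 : ℝ) T, HasDerivAt (fun s => W s i) (W' t i) t)
    (hs : ∀ t i, h * W' t i
          = -(1 / 6) * (W t (i + 1) ^ 2 + W t i * W t (i + 1)
              - W t i * W t (i - 1) - W t (i - 1) ^ 2)
            + νhat * ((W t (i + 1) - W t i) / h) - νhat * ((W t i - W t (i - 1)) / h))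
    (hD : ∀ x, ∀ t ∈ Ioo (0 : ℝ) T, (ux x t + pconst N (W t) x) / 2 ≤ D₀)
    (horth : ∀ v : ZMod N → ℝ, ∫ x in (0 : ℝ)..1, (u x 0 - plin N (W 0) x) * plin N v x = 0)
    (δ : ℝ) (hδ : 0 < δ) (p : ℝ → ℝ) (hp : ContDiff ℝ 2 p) (hpp : ∀ x, p (x + 1) = p x)
    (hpe : ∀ x, -δ ^ 2 * iteratedDeriv 2 p x + p x = u x T - plin N (W T) x) :
    √(δ ^ 2 * (∫ x in (0 : ℝ)..1, deriv p x ^ 2) + ∫ x in (0 : ℝ)..1, p x ^ 2)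
      ≤ (Real.exp (D₀ * T) *
        (h * √(∫ x in (0 : ℝ)..1, (u x 0 - plin N (W 0) x) ^ 2)
          + √(∫ t in (0 : ℝ)..T, 3 / 2 * h ^ 3 * (ν * ∑ i : ZMod N,
              ((W t (i + 1) - W t i) / h - (W t i - W t (i - 1)) / h) ^ 2))
          + 2 * ∫ t in (0 : ℝ)..T, (h * resinf N (W t)
            + 6 * √(h * U₀) * √(h * ∑ i : ZMod N, max 0 (νhat - ν) * ((W t (i + 1) - W t i) / h) ^ 2)
            + h ^ 2 * √(h * ∑ i : ZMod N, ((W' t (i + 1) - W' t i) / h) ^ 2)))) / δ := by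
  have hN : (0 : ℝ) < N := by exact_mod_cast NeZero.pos N
  have hh0 : 0 < h := by rw [hh]; positivity
  set e : ℝ → ℝ → ℝ := fun x t => u x t - plin N (W t) x with he
  set et : ℝ → ℝ → ℝ := fun x t => ut x t - plin N (W' t) x with het
  have cW := plin_joint N W hWc
  have cW' := plin_joint N W' hW'c
  have ce : Continuous fun p : ℝ × ℝ => e p.1 p.2 := huc.sub cW
  have cet : Continuous fun p : ℝ × ℝ => et p.1 p.2 := hutc.sub cW'
  have het' : ∀ x, ∀ t ∈ Ioo (0 : ℝ) T, HasDerivAt (fun s => e x s) (et x t) t := fun x t ht =>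
    (hut x t ht).sub (plin_deriv_t N W (W' t) x t fun i => hWd i t ht)
  have slice : ∀ (f : ℝ → ℝ → ℝ), (Continuous fun p : ℝ × ℝ => f p.1 p.2) → ∀ t,
      Continuous fun x => f x t := fun f hf t =>
    hf.comp (by fun_prop : Continuous fun x : ℝ => (x, t))
  have hep : ∀ x t, e (x + 1) t = e x t := fun x t => by
    simp only [he, hper, plin_periodic]
  have hu10 : ∀ t, u 1 t = u 0 t := fun t => by simpa using hper 0 t
  have hux10 : ∀ t, ux 1 t = ux 0 t := fun t => by
    simpa using periodic_deriv (fun x => u x t) (fun x => ux x t) (fun x => hper x t)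
      (fun x => hux x t) 0
  have met : ∀ t ∈ Ioo (0 : ℝ) T, ∫ x in (0 : ℝ)..1, et x t = 0 := by
    intro t ht
    have h1 := int_ut_zero ν (fun x => u x t) (fun x => ux x t) (fun x => uxx x t)
      (fun x => ut x t) (hu10 t) (hux10 t) (slice uxx huxxc t) (fun x => hux x t)
      (fun x => huxx x t) (fun x => hpde x t ht)
    have h2 := integral_plin N (W' t)
    rw [sum_w'_zero N h νhat hh0 (W t) (W' t) (hs t), mul_zero] at h2
    simp only [het]
    rw [intervalIntegral.integral_sub ((slice ut hutc t).intervalIntegrable _ _)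
      ((plin_continuous N (W' t)).intervalIntegrable _ _), h1, h2, sub_zero]
  have me0 : ∫ x in (0 : ℝ)..1, e x 0 = 0 := by
    have := horth fun _ => 1
    simpa only [plin_const_one, mul_one] using this
  have me : ∀ t ∈ Icc (0 : ℝ) T, ∫ x in (0 : ℝ)..1, e x t = 0 := by
    intro t ht
    refine (const_of_deriv_zero T (fun t => ∫ x in (0 : ℝ)..1, e x t)
      (cont_int01 e ce) ?_ t ht).trans me0
    intro s hs
    have := param_deriv T 0 1 e et ce cet het' s hs
    rwa [met s hs] at this
  set E : ℝ → ℝ → ℝ := prim e with hE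
  set Et : ℝ → ℝ → ℝ := prim et with hEt
  have cE : Continuous fun p : ℝ × ℝ => E p.1 p.2 := prim_cont e ce
  have cEt : Continuous fun p : ℝ × ℝ => Et p.1 p.2 := prim_cont et cet
  have dE := prim_deriv_x e ce
  have dEt := prim_deriv_x et cet
  have hEt' := prim_deriv_t T e et ce cet het'
  have Ep : ∀ t ∈ Icc (0 : ℝ) T, ∀ x, E (x + 1) t = E x t := fun t ht =>
    prim_periodic e ce t (fun x => hep x t) (me t ht)
  have E10 : ∀ t ∈ Icc (0 : ℝ) T, E 1 t = E 0 t := fun t ht => prim_one_zero e t (me t ht)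
  have mE := prim_mean e ce
  set ψ : ℝ → ℝ → ℝ := fun x t => ∫ y in (0 : ℝ)..x, E y t with hψ
  have ψp : ∀ t ∈ Icc (0 : ℝ) T, ∀ x, ψ (x + 1) t = ψ x t := fun t ht x =>
    periodic_primitive (fun x => E x t) (slice E cE t) (Ep t ht) (mE t) x
  have dψ : ∀ x t, HasDerivAt (fun y => ψ y t) (E x t) x := fun x t =>
    ((slice E cE t).integral_hasStrictDerivAt 0 x).hasDerivAt
  have cE2 : Continuous fun p : ℝ × ℝ => E p.1 p.2 ^ 2 := cE.pow 2
  have cEE : Continuous fun p : ℝ × ℝ => 2 * E p.1 p.2 * Et p.1 p.2 :=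
    (continuous_const.mul cE).mul cEt
  have dg := param_deriv T 0 1 (fun x t => E x t ^ 2) (fun x t => 2 * E x t * Et x t) cE2 cEE
    (fun x t ht => ((hEt' x t ht).pow 2).congr_deriv (by simp [hE, hEt]))
  have hf := filter_est δ hδ p (fun x => E x T) (fun x => e x T) hp hpp
    (E10 T ⟨hT.le, le_rfl⟩) (slice e ce T) (fun x => dE x T) hpe
  refine hf.trans ?_
  apply div_le_div_of_nonneg_right _ hδ.le
  have hini := init_est N (fun x => e x 0) (fun x => ψ x 0) (fun x => E x 0)
    (ψp 0 ⟨le_rfl, hT.le⟩) (slice e ce 0) (E10 0 ⟨le_rfl, hT.le⟩) (fun x => dψ x 0)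
    (fun x => dE x 0) horth
  rw [← hh] at hini
  have iA1 := resinf_integrable N W hWc 0 T
  have cS2 : Continuous fun t =>
      √(h * ∑ i : ZMod N, max 0 (νhat - ν) * ((W t (i + 1) - W t i) / h) ^ 2) := by
    apply Real.continuous_sqrt.comp
    refine continuous_const.mul (continuous_finsetSum _ fun i _ => ?_)
    have h1 := hWc i
    have h2 := hWc (i + 1)
    fun_prop
  have cS3 : Continuous fun t => √(h * ∑ i : ZMod N, ((W' t (i + 1) - W' t i) / h) ^ 2) := by
    apply Real.continuous_sqrt.comp
    refine continuous_const.mul (continuous_finsetSum _ fun i _ => ?_)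
    have h1 := hW'c i
    have h2 := hW'c (i + 1)
    fun_prop
  have cB : Continuous fun t => 3 / 2 * h ^ 3 * (ν * ∑ i : ZMod N,
              ((W t (i + 1) - W t i) / h - (W t i - W t (i - 1)) / h) ^ 2) := by
    refine continuous_const.mul (continuous_const.mul (continuous_finsetSum _ fun i _ => ?_))
    have h1 := hWc i
    have h2 := hWc (i + 1)
    have h3 := hWc (i - 1)
    fun_prop
  have hgr := gronwall_sqrt T D₀ hT hD₀ (fun t => ∫ x in (0 : ℝ)..1, E x t ^ 2)
    (fun t => ∫ x in (0 : ℝ)..1, 2 * E x t * Et x t)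
    (fun t => h * resinf N (W t)
            + 6 * √(h * U₀) * √(h * ∑ i : ZMod N, max 0 (νhat - ν) * ((W t (i + 1) - W t i) / h) ^ 2)
            + h ^ 2 * √(h * ∑ i : ZMod N, ((W' t (i + 1) - W' t i) / h) ^ 2))
    (fun t => 3 / 2 * h ^ 3 * (ν * ∑ i : ZMod N,
              ((W t (i + 1) - W t i) / h - (W t i - W t (i - 1)) / h) ^ 2))
    (fun t => intervalIntegral.integral_nonneg zero_le_one fun x _ => sq_nonneg _)
    (cont_int01 (fun x t => E x t ^ 2) cE2) dg
    (fun t => by have := resinf_nonneg N (W t); positivity) (fun t => by positivity) ?_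
    (((iA1.const_mul h).add ((cS2.intervalIntegrable _ _).const_mul _)).add
      ((cS3.intervalIntegrable _ _).const_mul _)) (cB.intervalIntegrable _ _)
  · refine hgr.trans (mul_le_mul_of_nonneg_left ?_ (Real.exp_pos _).le)
    have : √(∫ x in (0 : ℝ)..1, E x 0 ^ 2)
      ≤ h * √(∫ x in (0 : ℝ)..1, (u x 0 - plin N (W 0) x) ^ 2) := hini
    linarith
  · intro t ht
    have htI : t ∈ Icc (0 : ℝ) T := ⟨ht.1.le, ht.2.le⟩
    have b := ibp_periodic (fun x => Et x t) (fun x => ψ x t) (fun x => et x t) (fun x => E x t)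
      (slice Et cEt t)
      (continuous_iff_continuousAt.2 fun x => (dψ x t).continuousAt)
      (fun x => (dEt x t).hasDerivWithinAt) (fun x => (dψ x t).hasDerivWithinAt)
      ((slice et cet t).intervalIntegrable _ _) ((slice E cE t).intervalIntegrable _ _)
      (prim_one_zero et t (met t ht)) (by simpa using ψp t htI 0)
    have e1 : ∫ x in (0 : ℝ)..1, 2 * E x t * Et x t
        = -(2 * ∫ x in (0 : ℝ)..1, (ut x t - plin N (W' t) x) * ψ x t) := by
      have : ∀ x, 2 * E x t * Et x t = 2 * (Et x t * E x t) := fun x => by ring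
      simp only [this]
      rw [intervalIntegral.integral_const_mul]
      have b' : ∫ x in (0 : ℝ)..1, (ut x t - plin N (W' t) x) * ψ x t
        = -∫ x in (0 : ℝ)..1, Et x t * E x t := b
      rw [b']; ring
    have st := static_est N h hh ν νhat U₀ D₀ hν0 hνν hνU hU₀ (fun x => u x t) (fun x => ux x t)
      (fun x => uxx x t) (fun x => ut x t) (fun x => ψ x t) (fun x => E x t) (fun x => e x t)
      (W t) (W' t) (hu10 t) (hux10 t) (ψp t htI) (E10 t htI) (slice uxx huxxc t)
      (slice ut hutc t) (fun x => hux x t) (fun x => huxx x t) (fun x => dψ x t)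
      (fun x => dE x t) (fun x => rfl) (fun x => hpde x t ht) (fun x => hD x t ht) (hs t)
    simp only [e1]
    set G := ∫ x in (0 : ℝ)..1, E x t ^ 2 with hG
    set S2 := √(h * ∑ i : ZMod N, max 0 (νhat - ν) * ((W t (i + 1) - W t i) / h) ^ 2)
    set S3 := √(h * ∑ i : ZMod N, ((W' t (i + 1) - W' t i) / h) ^ 2)
    set B := 3 / 2 * h ^ 3 * (ν * ∑ i : ZMod N,
              ((W t (i + 1) - W t i) / h - (W t i - W t (i - 1)) / h) ^ 2)
    set X := -(2 * ∫ x in (0 : ℝ)..1, (ut x t - plin N (W' t) x) * ψ x t)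
    have hinf : X - D₀ * G - 2 * √G * (6 * √(h * U₀) * S2 + h ^ 2 * S3) - B
        ≤ (2 * √G * h) * resinf N (W t) := by
      unfold resinf
      rw [Real.mul_iInf_of_nonneg (by positivity)]
      refine le_ciInf fun z => ?_
      have := st z
      linarith
    linarith


lemma sup_deriv (u₀ : ℝ → ℝ) (hu : ContDiff ℝ 1 u₀) (hp : ∀ x, u₀ (x + 1) = u₀ x) :
    0 ≤ sSup (deriv u₀ '' Icc (0 : ℝ) 1) ∧ ∀ x, deriv u₀ x ≤ sSup (deriv u₀ '' Icc (0 : ℝ) 1) := by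
  have cd : Continuous (deriv u₀) := hu.continuous_deriv (by norm_num)
  have hb : BddAbove (deriv u₀ '' Icc (0 : ℝ) 1) :=
    (isCompact_Icc.image cd).bddAbove
  have dper : ∀ x, deriv u₀ (x + 1) = deriv u₀ x :=
    periodic_deriv u₀ (deriv u₀) hp fun x => (hu.differentiable (by norm_num) x).hasDerivAt
  constructor
  · obtain ⟨c, hc, hc0⟩ := exists_deriv_eq_zero (f := u₀) zero_lt_one hu.continuous.continuousOn
      (by simpa using (hp 0).symm)
    exact le_csSup hb ⟨c, ⟨hc.1.le, hc.2.le⟩, hc0⟩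
  · intro x
    have hp1 : Function.Periodic (deriv u₀) 1 := dper
    have := hp1.sub_zsmul_eq (x := x) ⌊x⌋
    simp only [zsmul_eq_mul, mul_one, Int.self_sub_floor] at this
    rw [← this]
    exact le_csSup hb ⟨Int.fract x, ⟨Int.fract_nonneg _, (Int.fract_lt_one _).le⟩, rfl⟩

lemma sup_slope_nonneg (N : ℕ) [NeZero N] (h : ℝ) (w : ZMod N → ℝ) (Mh : ℝ)
    (hM : ∀ i, (w (i + 1) - w i) / h ≤ Mh) : 0 ≤ Mh := by
  by_contra hcon
  push Not at hcon
  have h0 : ∑ i, (w (i + 1) - w i) / h = 0 := by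
    rw [← Finset.sum_div, Finset.sum_sub_distrib, sum_shift N w, sub_self, zero_div]
  have : ∑ i, (w (i + 1) - w i) / h < ∑ i : ZMod N, (0 : ℝ) :=
    Finset.sum_lt_sum_of_nonempty ⟨0, Finset.mem_univ _⟩ fun i _ => (hM i).trans_lt hcon
  simp [h0] at this

set_option maxHeartbeats 1600000 in
/-- **A posteriori error estimate for filtered quantities** (Theorem 5.1, first
part): the `δ`-filtered error `⟦ẽ⟧_δ` of the stabilized finite element solution
of the Burgers equation is bounded, with a constant independent of `N`, `h`,
`ν`, `δ`, `T` and the data, by `exp(D₀T) (h/δ²)^{1/2}` times computable residual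
quantities. -/
theorem aposteriori_error_estimate_filtered :
    ∃ C : ℝ, 0 < C ∧
      ∀ (N : ℕ) [NeZero N], 3 ≤ N →
      ∀ T ν : ℝ, 0 < T → 0 ≤ ν →
      -- smooth 1-periodic initial data
      ∀ u₀ : ℝ → ℝ, ContDiff ℝ (⊤ : ℕ∞) u₀ → (∀ x, u₀ (x + 1) = u₀ x) →
      -- u : smooth 1-periodic solution of the Burgers equation
      ∀ u ux uxx ut : ℝ → ℝ → ℝ,
      (∀ x t, u (x + 1) t = u x t) →
      (Continuous fun p : ℝ × ℝ => u p.1 p.2) →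
      (Continuous fun p : ℝ × ℝ => ux p.1 p.2) →
      (Continuous fun p : ℝ × ℝ => uxx p.1 p.2) →
      (Continuous fun p : ℝ × ℝ => ut p.1 p.2) →
      (∀ x t, HasDerivAt (fun y => u y t) (ux x t) x) →
      (∀ x t, HasDerivAt (fun y => ux y t) (uxx x t) x) →
      (∀ x, ∀ t ∈ Icc (0 : ℝ) T,
        HasDerivWithinAt (fun s => u x s) (ut x t) (Icc (0 : ℝ) T) t) →
      (∀ x, ∀ t ∈ Ioc (0 : ℝ) T,
        ut x t + u x t * ux x t - ν * uxx x t = 0) →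
      (∀ x, u x 0 = u₀ x) →
      -- u_h : mass-lumped Galerkin scheme with linear artificial viscosity
      ∀ w w' : ℝ → ZMod N → ℝ, ∀ h : ℝ, h = 1 / N →
      ∀ d : ℝ → ZMod N → ℝ, (∀ t i, d t i = (w t (i + 1) - w t i) / h) →
      ∀ U₀ : ℝ,
        U₀ = (Finset.univ.sup' ⟨(0 : ZMod N), Finset.mem_univ _⟩
          fun j => |w 0 j|) →
      ∀ νhat : ℝ, νhat = max (U₀ * h / 2) ν →
      (∀ i, ∀ t ∈ Icc (0 : ℝ) T,
        HasDerivWithinAt (fun s => w s i) (w' t i) (Icc (0 : ℝ) T) t) →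
      (∀ i, ∀ t ∈ Icc (0 : ℝ) T,
        h * w' t i
          = -(1 / 6) * (w t (i + 1) ^ 2 + w t i * w t (i + 1)
              - w t i * w t (i - 1) - w t (i - 1) ^ 2)
            + νhat * d t i - νhat * d t (i - 1)) →
      -- initial data : u_h(·,0) = π_h u₀  (L²-orthogonality of the residual)
      (∀ v : ZMod N → ℝ,
        (∫ x in (0 : ℝ)..1, (u₀ x - plin N (w 0) x) * plin N v x) = 0) →
      -- D₀ := (1/2)(sup u₀' + maxᵢ dᵢ(0)) ≥ 0
      ∀ D₀ : ℝ,
        D₀ = (1 / 2) * (sSup (deriv u₀ '' Icc (0 : ℝ) 1)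
          + Finset.univ.sup' ⟨(0 : ZMod N), Finset.mem_univ _⟩ fun i => d 0 i) →
        0 ≤ D₀ →
      -- the differential filters of u(·,T) and u_h(·,T), of width δ
      ∀ δ : ℝ, 0 < δ →
      ∀ utilde uhtilde : ℝ → ℝ,
      ContDiff ℝ 2 utilde → (∀ x, utilde (x + 1) = utilde x) →
      (∀ x, -δ ^ 2 * iteratedDeriv 2 utilde x + utilde x = u x T) →
      ContDiff ℝ 2 uhtilde → (∀ x, uhtilde (x + 1) = uhtilde x) →
      (∀ x, -δ ^ 2 * iteratedDeriv 2 uhtilde x + uhtilde x = plin N (w T) x) →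
      -- a smooth solution φ of the dual adjoint problem with coefficient
      -- a := (u + u_h)/2 and terminal data ẽ := ũ − ũ_h
      ∀ φ φx φxx φt : ℝ → ℝ → ℝ,
      (∀ x t, φ (x + 1) t = φ x t) →
      (Continuous fun p : ℝ × ℝ => φ p.1 p.2) →
      (Continuous fun p : ℝ × ℝ => φx p.1 p.2) →
      (Continuous fun p : ℝ × ℝ => φxx p.1 p.2) →
      (Continuous fun p : ℝ × ℝ => φt p.1 p.2) →
      (∀ x t, HasDerivAt (fun y => φ y t) (φx x t) x) →
      (∀ x t, HasDerivAt (fun y => φx y t) (φxx x t) x) →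
      (∀ x, ∀ t ∈ Icc (0 : ℝ) T,
        HasDerivWithinAt (fun s => φ x s) (φt x t) (Icc (0 : ℝ) T) t) →
      (∀ x, ∀ t ∈ Ioo (0 : ℝ) T,
        -φt x t + ((u x t + plin N (w t) x) / 2) * φx x t - ν * φxx x t = 0) →
      (∀ x, φ x T = utilde x - uhtilde x) →
      -- a posteriori error estimate for the filtered error
      Real.sqrt (δ ^ 2 * (∫ x in (0 : ℝ)..1,
              (deriv (fun y => utilde y - uhtilde y) x) ^ 2)
            + ∫ x in (0 : ℝ)..1, (utilde x - uhtilde x) ^ 2)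
        ≤ C * Real.exp (D₀ * T) * Real.sqrt (h / δ ^ 2) *
            (Real.sqrt h
                * Real.sqrt (∫ x in (0 : ℝ)..1, (u₀ x - plin N (w 0) x) ^ 2)
              + Real.sqrt h * (∫ t in (0 : ℝ)..T, ⨅ v : ZMod N → ℝ,
                  Real.sqrt (∫ x in (0 : ℝ)..1,
                    (plin N v x + plin N (w t) x * pconst N (w t) x) ^ 2))
              + Real.sqrt U₀ * (∫ t in (0 : ℝ)..T,
                  Real.sqrt (h * ∑ i : ZMod N, max 0 (νhat - ν) * d t i ^ 2))
              + h * Real.sqrt h * (∫ t in (0 : ℝ)..T,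
                  Real.sqrt (h * ∑ i : ZMod N, ((w' t (i + 1) - w' t i) / h) ^ 2))
              + h * Real.sqrt (ν * ∫ t in (0 : ℝ)..T,
                  ∑ i : ZMod N, (d t i - d t (i - 1)) ^ 2)) := by
  refine ⟨12, by norm_num, ?_⟩
  intro N _ hN3 T ν hT hν u₀ hu₀ hu₀p u ux uxx ut hper huc huxc huxxc hutc hux huxx hut hpde hinit
    w w' h hh d hd U₀ hU₀ νhat hνhat hw hs horth D₀ hD₀ hD₀0 δ hδ utilde uhtilde hut2 hutp hute
    huh2 huhp huhe φ φx φxx φt _ _ _ _ _ _ _ _ _ _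
  have hN : (0 : ℝ) < N := by exact_mod_cast NeZero.pos N
  have hh0 : 0 < h := by rw [hh]; positivity
  have hu1 : ContDiff ℝ 1 u₀ := hu₀.of_le (by exact_mod_cast le_top)
  simp only [hd] at hs
  have hs1 : ∀ i, ∀ t ∈ Icc (0 : ℝ) T,
        h * w' t i
          = -(1 / 6) * (w t (i + 1) ^ 2 + w t i * w t (i + 1)
              - w t i * w t (i - 1) - w t (i - 1) ^ 2)
            + νhat * ((w t (i + 1) - w t i) / h) - νhat * ((w t i - w t (i - 1)) / h) := by
    intro i t ht
    have := hs i t ht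
    rwa [sub_add_cancel] at this
  have hUle : ∀ i, |w 0 i| ≤ U₀ := fun i => by
    rw [hU₀]; exact Finset.le_sup' (fun j => |w 0 j|) (Finset.mem_univ i)
  have hU0 : 0 ≤ U₀ := (abs_nonneg _).trans (hUle 0)
  have hν1 : U₀ * h / 2 ≤ νhat := by rw [hνhat]; exact le_max_left _ _
  have hν2 : ν ≤ νhat := by rw [hνhat]; exact le_max_right _ _
  have hν3 : νhat - ν ≤ U₀ * h / 2 := by
    have : 0 ≤ U₀ * h / 2 := by positivity
    rw [hνhat]
    rcases max_cases (U₀ * h / 2) ν with ⟨h1, _⟩ | ⟨h1, _⟩ <;> rw [h1] <;> linarith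
  obtain ⟨hM0, hM⟩ := sup_deriv u₀ hu1 hu₀p
  set M := sSup (deriv u₀ '' Icc (0 : ℝ) 1) with hMdef
  set Mh := Finset.univ.sup' ⟨(0 : ZMod N), Finset.mem_univ _⟩ (fun i => d 0 i) with hMh
  have hMhle : ∀ i, (w 0 (i + 1) - w 0 i) / h ≤ Mh := fun i => by
    rw [← hd]; exact Finset.le_sup' (fun i => d 0 i) (Finset.mem_univ i)
  have hMh0 : 0 ≤ Mh := sup_slope_nonneg N h (w 0) Mh hMhle
  have hwb := scheme_bound N T h νhat U₀ hh0 hT hν1 w w' hUle hw hs1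
  have hwsl := scheme_slope N T h νhat U₀ Mh hh0 hT hν1 w w' hMh0 hwb hw hs1 hMhle
  have husl := burgers_slope T ν M hT hν hM0 u₀ (hu1.differentiable (by norm_num)) hM u ux uxx ut
    hper huc hux huxx hut hpde hinit
  -- clamped extension
  set cl : ℝ → ℝ := fun t => max 0 (min T t) with hcl
  have clc : Continuous cl := by fun_prop
  have clI : ∀ t, cl t ∈ Icc (0 : ℝ) T := fun t =>
    ⟨le_max_left _ _, max_le hT.le (min_le_left _ _)⟩
  have cle : ∀ t ∈ Icc (0 : ℝ) T, cl t = t := fun t ht => by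
    simp only [hcl, min_eq_right ht.2, max_eq_right ht.1]
  set W : ℝ → ZMod N → ℝ := fun t i => w (cl t) i with hW
  set W' : ℝ → ZMod N → ℝ := fun t i => w' (cl t) i with hW'
  have hWeq : ∀ t ∈ Icc (0 : ℝ) T, W t = w t := fun t ht => by
    funext i; simp only [hW, cle t ht]
  have hW'eq : ∀ t ∈ Icc (0 : ℝ) T, W' t = w' t := fun t ht => by
    funext i; simp only [hW', cle t ht]
  have hsW : ∀ t i, h * W' t i
          = -(1 / 6) * (W t (i + 1) ^ 2 + W t i * W t (i + 1)
              - W t i * W t (i - 1) - W t (i - 1) ^ 2)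
            + νhat * ((W t (i + 1) - W t i) / h) - νhat * ((W t i - W t (i - 1)) / h) :=
    fun t i => hs1 i (cl t) (clI t)
  have hWc : ∀ i, Continuous fun t => W t i := fun i =>
    ContinuousOn.comp_continuous (f := cl) (g := fun s => w s i)
      (fun t ht => (hw i t ht).continuousWithinAt) clc clI
  have hW'c : ∀ i, Continuous fun t => W' t i := by
    intro i
    have : (fun t => W' t i) = fun t => h⁻¹ * (-(1 / 6) * (W t (i + 1) ^ 2 + W t i * W t (i + 1)
              - W t i * W t (i - 1) - W t (i - 1) ^ 2)
            + νhat * ((W t (i + 1) - W t i) / h) - νhat * ((W t i - W t (i - 1)) / h)) := by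
      funext t
      rw [← hsW t i, inv_mul_cancel_left₀ hh0.ne']
    rw [this]
    have h1 := hWc i
    have h2 := hWc (i + 1)
    have h3 := hWc (i - 1)
    fun_prop
  have hWd : ∀ i, ∀ t ∈ Ioo (0 : ℝ) T, HasDerivAt (fun s => W s i) (W' t i) t := by
    intro i t ht
    have htI : t ∈ Icc (0 : ℝ) T := ⟨ht.1.le, ht.2.le⟩
    have h1 := (hw i t htI).hasDerivAt (Icc_mem_nhds ht.1 ht.2)
    rw [hW'eq t htI]
    refine h1.congr_of_eventuallyEq ?_
    filter_upwards [Icc_mem_nhds ht.1 ht.2] with s hs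
    rw [hWeq s hs]
  have hDx : ∀ x, ∀ t ∈ Ioo (0 : ℝ) T, (ux x t + pconst N (W t) x) / 2 ≤ D₀ := by
    intro x t ht
    have htI : t ∈ Icc (0 : ℝ) T := ⟨ht.1.le, ht.2.le⟩
    have h1 := husl x t htI
    have h2 : pconst N (W t) x ≤ Mh := by
      rw [hWeq t htI]
      apply pconst_le
      intro i
      have := hwsl i t htI
      rw [hh] at this
      refine le_trans (le_of_eq ?_) this
      field_simp
    rw [hD₀]; linarith
  have h0I : (0 : ℝ) ∈ Icc (0 : ℝ) T := ⟨le_rfl, hT.le⟩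
  have hTI : T ∈ Icc (0 : ℝ) T := ⟨hT.le, le_rfl⟩
  have pC : ContDiff ℝ 2 fun x => utilde x - uhtilde x := hut2.sub huh2
  have main := dynamic N h hh T ν νhat U₀ D₀ hT hν hν2 hν3 hU0 hD₀0 u ux uxx ut W W' hper huc huxxc
    hutc hux huxx
    (fun x t ht => (hut x t ⟨ht.1.le, ht.2.le⟩).hasDerivAt (Icc_mem_nhds ht.1 ht.2))
    (fun x t ht => hpde x t ⟨ht.1, ht.2.le⟩) hWc hW'c hWd hsW hDx
    (by simpa only [hinit, hWeq 0 h0I] using horth) δ hδ (fun x => utilde x - uhtilde x)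
    pC (fun x => by rw [hutp, huhp]) (fun x => by
      have e1 : iteratedDeriv 2 (fun x => utilde x - uhtilde x) x
          = iteratedDeriv 2 utilde x - iteratedDeriv 2 uhtilde x :=
        iteratedDeriv_fun_sub hut2.contDiffAt huh2.contDiffAt
      rw [e1, ← hute x, hWeq T hTI, ← huhe x]
      ring)
  refine main.trans ?_
  simp only [hinit, hWeq 0 h0I]
  -- rewrite time integrals
  have iA1 := resinf_integrable N W hWc 0 T
  have cS2 : Continuous fun t =>
      √(h * ∑ i : ZMod N, max 0 (νhat - ν) * ((W t (i + 1) - W t i) / h) ^ 2) := by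
    apply Real.continuous_sqrt.comp
    refine continuous_const.mul (continuous_finsetSum _ fun i _ => ?_)
    have h1 := hWc i
    have h2 := hWc (i + 1)
    fun_prop
  have cS3 : Continuous fun t => √(h * ∑ i : ZMod N, ((W' t (i + 1) - W' t i) / h) ^ 2) := by
    apply Real.continuous_sqrt.comp
    refine continuous_const.mul (continuous_finsetSum _ fun i _ => ?_)
    have h1 := hW'c i
    have h2 := hW'c (i + 1)
    fun_prop
  have iS2 := (cS2.intervalIntegrable (μ := volume) 0 T).const_mul (6 * √(h * U₀))
  have iS3 := (cS3.intervalIntegrable (μ := volume) 0 T).const_mul (h ^ 2)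
  rw [intervalIntegral.integral_add ((iA1.const_mul h).add iS2) iS3,
    intervalIntegral.integral_add (iA1.const_mul h) iS2,
    intervalIntegral.integral_const_mul, intervalIntegral.integral_const_mul,
    intervalIntegral.integral_const_mul, intervalIntegral.integral_const_mul,
    intervalIntegral.integral_const_mul]
  have uI : uIcc (0 : ℝ) T = Icc 0 T := uIcc_of_le hT.le
  have q1 : ∫ t in (0 : ℝ)..T, resinf N (W t)
      = ∫ t in (0 : ℝ)..T, ⨅ v : ZMod N → ℝ,
                  √(∫ x in (0 : ℝ)..1,
                    (plin N v x + plin N (w t) x * pconst N (w t) x) ^ 2) := by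
    apply intervalIntegral.integral_congr
    intro t ht
    rw [uI] at ht
    simp only [hWeq t ht]
    rfl
  have q2 : ∫ t in (0 : ℝ)..T, √(h * ∑ i : ZMod N, max 0 (νhat - ν) * ((W t (i + 1) - W t i) / h) ^ 2)
      = ∫ t in (0 : ℝ)..T, √(h * ∑ i : ZMod N, max 0 (νhat - ν) * d t i ^ 2) := by
    apply intervalIntegral.integral_congr
    intro t ht
    rw [uI] at ht
    simp only [hWeq t ht, hd]
  have q3 : ∫ t in (0 : ℝ)..T, √(h * ∑ i : ZMod N, ((W' t (i + 1) - W' t i) / h) ^ 2)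
      = ∫ t in (0 : ℝ)..T, √(h * ∑ i : ZMod N, ((w' t (i + 1) - w' t i) / h) ^ 2) := by
    apply intervalIntegral.integral_congr
    intro t ht
    rw [uI] at ht
    simp only [hW'eq t ht]
  have q4 : ∫ t in (0 : ℝ)..T, ∑ i : ZMod N,
              ((W t (i + 1) - W t i) / h - (W t i - W t (i - 1)) / h) ^ 2
      = ∫ t in (0 : ℝ)..T, ∑ i : ZMod N, (d t i - d t (i - 1)) ^ 2 := by
    apply intervalIntegral.integral_congr
    intro t ht
    rw [uI] at ht
    simp only [hWeq t ht, hd, sub_add_cancel]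
  rw [q1, q2, q3, q4]
  have n1 : 0 ≤ ∫ t in (0 : ℝ)..T, ⨅ v : ZMod N → ℝ,
                  √(∫ x in (0 : ℝ)..1,
                    (plin N v x + plin N (w t) x * pconst N (w t) x) ^ 2) :=
    intervalIntegral.integral_nonneg hT.le fun t _ => resinf_nonneg N (w t)
  have n2 : 0 ≤ ∫ t in (0 : ℝ)..T, √(h * ∑ i : ZMod N, max 0 (νhat - ν) * d t i ^ 2) :=
    intervalIntegral.integral_nonneg hT.le fun t _ => Real.sqrt_nonneg _
  have n3 : 0 ≤ ∫ t in (0 : ℝ)..T, √(h * ∑ i : ZMod N, ((w' t (i + 1) - w' t i) / h) ^ 2) :=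
    intervalIntegral.integral_nonneg hT.le fun t _ => Real.sqrt_nonneg _
  have n0 := Real.sqrt_nonneg (∫ x in (0 : ℝ)..1, (u₀ x - plin N (w 0) x) ^ 2)
  have n4 := Real.sqrt_nonneg (ν * ∫ t in (0 : ℝ)..T, ∑ i : ZMod N, (d t i - d t (i - 1)) ^ 2)
  generalize (∫ t in (0 : ℝ)..T, ⨅ v : ZMod N → ℝ,
                  √(∫ x in (0 : ℝ)..1,
                    (plin N v x + plin N (w t) x * pconst N (w t) x) ^ 2)) = X1 at *
  generalize (∫ t in (0 : ℝ)..T, √(h * ∑ i : ZMod N, max 0 (νhat - ν) * d t i ^ 2)) = X2 at *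
  generalize (∫ t in (0 : ℝ)..T, √(h * ∑ i : ZMod N, ((w' t (i + 1) - w' t i) / h) ^ 2)) = X3 at *
  generalize √(∫ x in (0 : ℝ)..1, (u₀ x - plin N (w 0) x) ^ 2) = X0 at *
  generalize (ν * ∫ t in (0 : ℝ)..T, ∑ i : ZMod N, (d t i - d t (i - 1)) ^ 2) = Y at *
  clear main q1 q2 q3 q4
  have r1 : √(h / δ ^ 2) = √h / δ := by
    rw [Real.sqrt_div hh0.le, Real.sqrt_sq hδ.le]
  have r2 : √(h * U₀) = √h * √U₀ := Real.sqrt_mul hh0.le _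
  set s := √h with hsd
  have s0 : 0 ≤ s := Real.sqrt_nonneg _
  have s2 : h = s ^ 2 := (Real.sq_sqrt hh0.le).symm
  have r3 : √(3 / 2 * h ^ 3 * Y) ≤ 2 * s ^ 3 * √Y := by
    rw [Real.sqrt_mul (by positivity)]
    apply mul_le_mul_of_nonneg_right _ n4
    rw [Real.sqrt_le_left (by positivity), s2]
    have : 0 ≤ s ^ 6 := by positivity
    nlinarith
  rw [r1, r2, div_le_iff₀ hδ]
  have hex := Real.exp_pos (D₀ * T)
  have hUs := Real.sqrt_nonneg U₀
  have e1 : 12 * Real.exp (D₀ * T) * (s / δ) *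
      (s * X0 + s * X1 + √U₀ * X2 + h * s * X3 + h * √Y) * δ
      = Real.exp (D₀ * T) * (12 * s * (s * X0 + s * X1 + √U₀ * X2 + h * s * X3 + h * √Y)) := by
    field_simp
  rw [e1]
  apply mul_le_mul_of_nonneg_left _ hex.le
  rw [s2] at r3 ⊢
  have t0 : 0 ≤ s ^ 2 * X0 := by positivity
  have t1 : 0 ≤ s ^ 2 * X1 := by positivity
  have t3 : 0 ≤ s ^ 4 * X3 := by positivity
  have t4 : 0 ≤ s ^ 3 * √Y := by positivity
  nlinarith
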